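/- arXiv:2308.01706 — 5 statements merged into one kernel-verified Lean document; each statement's English description precedes it below -/
import Mathlib

section
/- Missing branch extension (existence and uniqueness): let 1 ≤ i₀ ≤ n and suppose C¹ expanding branches f_i on I_i are given for all i ≠ i₀ and satisfy Σ_{i≠i₀} 1/(f_i'(f_i⁻¹(x))) < 1 for every x ∈ [0,1]. Then there exists exactly one C¹ expanding branch f_{i₀} on I_{i₀} such that the full branch map f defined by the branches f₁, …, fₙ preserves Lebesgue measure. -/
open Set MeasureTheory

/-- `g` (with derivative `g'`) is a C¹ expanding branch on the interval `[l, r]`. -/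
def IsBranch (l r : ℝ) (g g' : ℝ → ℝ) : Prop :=
  (∀ x ∈ Set.Icc l r, HasDerivWithinAt g (g' x) (Set.Icc l r) x) ∧
  ContinuousOn g' (Set.Icc l r) ∧
  (∀ x ∈ Set.Icc l r, 1 < g' x) ∧
  g l = 0 ∧ g r = 1

/-- `F` is the full branch map associated to the branches `f i` on the partition `a`. -/
def AgreesWith {n : ℕ} (a : Fin (n + 1) → ℝ) (f : Fin n → ℝ → ℝ) (F : ℝ → ℝ) : Prop :=
  (∀ i : Fin n, ∀ x ∈ Set.Ico (a i.castSucc) (a i.succ), F x = f i x) ∧ F 1 = 1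

/-- `F` preserves Lebesgue measure on `[0,1]`. -/
def PreservesLeb (F : ℝ → ℝ) : Prop :=
  ∀ A : Set ℝ, MeasurableSet A → A ⊆ Set.Icc 0 1 →
    volume (F ⁻¹' A ∩ Set.Icc 0 1) = volume A

/-- `ψ : [c, d] → [l, r]` is an increasing inverse of `g : [l, r] → [c, d]`, with the derivative
`1 / g'` prescribed by the inverse function theorem. -/
structure IsDiffInverse (l r c d : ℝ) (g g' ψ : ℝ → ℝ) : Prop where
  mapsTo : MapsTo g (Icc l r) (Icc c d)
  mapsTo_inv : MapsTo ψ (Icc c d) (Icc l r)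
  invOn : InvOn ψ g (Icc l r) (Icc c d)
  hasDerivWithinAt : ∀ x ∈ Icc c d, HasDerivWithinAt ψ (g' (ψ x))⁻¹ (Icc c d) x
  strictMonoOn : StrictMonoOn ψ (Icc c d)

theorem IsDiffInverse.continuousOn {l r c d : ℝ} {g g' ψ : ℝ → ℝ}
    (h : IsDiffInverse l r c d g g' ψ) : ContinuousOn ψ (Icc c d) :=
  fun x hx => (h.hasDerivWithinAt x hx).continuousWithinAt

/-- The inverse of a continuous bijection from a compact set is continuous. -/
theorem ContinuousOn.continuousOn_of_invOn {s t : Set ℝ} {g ψ : ℝ → ℝ} (hg : ContinuousOn g s)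
    (hs : IsCompact s) (hψ : MapsTo ψ t s) (hinv : InvOn ψ g s t) :
    ContinuousOn ψ t := by
  rw [continuousOn_iff_isClosed]
  intro C hC
  refine ⟨g '' (s ∩ C), ((hs.inter_right hC).image_of_continuousOn
    (hg.mono inter_subset_left)).isClosed, ?_⟩
  ext x
  constructor
  · rintro ⟨hx, hxt⟩
    exact ⟨⟨ψ x, ⟨hψ hxt, hx⟩, hinv.2 hxt⟩, hxt⟩
  · rintro ⟨⟨y, ⟨hy, hyC⟩, rfl⟩, hxt⟩
    refine ⟨?_, hxt⟩
    rw [mem_preimage, hinv.1 hy]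
    exact hyC

/-- A differentiable function on `[l, r]` with positive derivative has a differentiable inverse. -/
theorem exists_isDiffInverse {l r : ℝ} (hlr : l ≤ r) {g g' : ℝ → ℝ}
    (hd : ∀ x ∈ Icc l r, HasDerivWithinAt g (g' x) (Icc l r) x) (hpos : ∀ x ∈ Icc l r, 0 < g' x) :
    ∃ ψ, IsDiffInverse l r (g l) (g r) g g' ψ := by
  have hgc : ContinuousOn g (Icc l r) := fun x hx => (hd x hx).continuousWithinAt
  have hgm : StrictMonoOn g (Icc l r) :=
    strictMonoOn_of_hasDerivWithinAt_pos (convex_Icc l r) hgc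
      (fun x hx => (hd x (interior_subset hx)).mono interior_subset)
      (fun x hx => hpos x (interior_subset hx))
  have hsurj : SurjOn g (Icc l r) (Icc (g l) (g r)) := intermediate_value_Icc hlr hgc
  have hmaps : MapsTo g (Icc l r) (Icc (g l) (g r)) := fun x hx =>
    ⟨hgm.monotoneOn (left_mem_Icc.2 hlr) hx hx.1, hgm.monotoneOn hx (right_mem_Icc.2 hlr) hx.2⟩
  have hinv := BijOn.invOn_invFunOn ⟨hmaps, hgm.injOn, hsurj⟩
  have hψ := hsurj.mapsTo_invFunOn
  set ψ := Function.invFunOn g (Icc l r)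
  have hψc := hgc.continuousOn_of_invOn isCompact_Icc hψ hinv
  refine ⟨ψ, hmaps, hψ, hinv, fun x hx => ?_, fun x hx y hy hxy => ?_⟩
  · have hne := (hpos _ (hψ hx)).ne'
    have hfd : HasFDerivWithinAt g
        (ContinuousLinearEquiv.unitsEquivAut ℝ (Units.mk0 (g' (ψ x)) hne) : ℝ →L[ℝ] ℝ)
        (Icc l r) (ψ x) := by
      refine (hd _ (hψ hx)).hasFDerivWithinAt.congr_fderiv ?_
      ext
      simp
    refine (hfd.of_local_left_inverse ((hψc x hx).tendsto_nhdsWithin hψ) hx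
      (Filter.eventually_of_mem self_mem_nhdsWithin fun y hy => hinv.2 hy)).congr_fderiv ?_
    ext
    simp
  · rw [← hgm.lt_iff_lt (hψ hx) (hψ hy), hinv.2 hx, hinv.2 hy]
    exact hxy

theorem IsBranch.exists_isDiffInverse {l r : ℝ} (hlr : l ≤ r) {g g' : ℝ → ℝ}
    (h : IsBranch l r g g') : ∃ ψ, IsDiffInverse l r 0 1 g g' ψ := by
  obtain ⟨hd, -, h1, h0, hr⟩ := h
  have := _root_.exists_isDiffInverse hlr hd fun x hx => zero_lt_one.trans (h1 x hx)
  rwa [h0, hr] at this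

theorem IsDiffInverse.apply_zero {l r : ℝ} (hlr : l ≤ r) {g g' ψ : ℝ → ℝ}
    (h : IsDiffInverse l r 0 1 g g' ψ) (hg : g l = 0) : ψ 0 = l := by
  rw [← hg]
  exact h.invOn.1 (left_mem_Icc.2 hlr)

theorem IsDiffInverse.apply_one {l r : ℝ} (hlr : l ≤ r) {g g' ψ : ℝ → ℝ}
    (h : IsDiffInverse l r 0 1 g g' ψ) (hg : g r = 1) : ψ 1 = r := by
  rw [← hg]
  exact h.invOn.1 (right_mem_Icc.2 hlr)

theorem IsDiffInverse.image_Ico {l r c d t : ℝ} {g g' ψ : ℝ → ℝ}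
    (h : IsDiffInverse l r c d g g' ψ) (ht : t ∈ Icc c d) :
    ψ '' Ico c t = Ico (ψ c) (ψ t) := by
  have hc : c ∈ Icc c d := left_mem_Icc.2 (ht.1.trans ht.2)
  apply Subset.antisymm
  · rintro _ ⟨x, hx, rfl⟩
    have hx' : x ∈ Icc c d := ⟨hx.1, hx.2.le.trans ht.2⟩
    exact ⟨h.strictMonoOn.monotoneOn hc hx' hx.1, h.strictMonoOn hx' ht hx.2⟩
  · intro y hy
    have hyI : y ∈ Icc l r :=
      ⟨(h.mapsTo_inv hc).1.trans hy.1, hy.2.le.trans (h.mapsTo_inv ht).2⟩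
    refine ⟨g y, ⟨(h.mapsTo hyI).1, ?_⟩, h.invOn.1 hyI⟩
    rw [← h.strictMonoOn.lt_iff_lt (h.mapsTo hyI) ht, h.invOn.1 hyI]
    exact hy.2

theorem exists_mem_Ico_castSucc_succ {m : ℕ} {a : Fin (m + 1) → ℝ} {x : ℝ} (h0 : a 0 ≤ x)
    (hx : x < a (Fin.last m)) : ∃ i : Fin m, x ∈ Ico (a i.castSucc) (a i.succ) := by
  by_contra! hcon
  have hle : ∀ j, a j ≤ x := fun j => by
    induction j using Fin.induction with
    | zero => exact h0
    | succ i ih => exact not_lt.1 fun hlt => hcon i ⟨ih, hlt⟩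
  exact (hle _).not_gt hx

theorem StrictMono.eq_of_mem_Ico_castSucc_succ {m : ℕ} {a : Fin (m + 1) → ℝ} (ha : StrictMono a)
    {x : ℝ} {i j : Fin m} (hi : x ∈ Ico (a i.castSucc) (a i.succ))
    (hj : x ∈ Ico (a j.castSucc) (a j.succ)) : i = j := by
  have h1 := ha.lt_iff_lt.1 (hi.1.trans_lt hj.2)
  have h2 := ha.lt_iff_lt.1 (hj.1.trans_lt hi.2)
  simp only [Fin.lt_def, Fin.val_castSucc, Fin.val_succ] at h1 h2
  omega

theorem Fin.sum_succ_sub_castSucc {m : ℕ} (a : Fin (m + 1) → ℝ) :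
    ∑ i : Fin m, (a i.succ - a i.castSucc) = a (Fin.last m) - a 0 := by
  have h1 := Fin.sum_univ_succ a
  have h2 := Fin.sum_univ_castSucc a
  rw [Finset.sum_sub_distrib]
  linarith

theorem exists_agreesWith {m : ℕ} {a : Fin (m + 1) → ℝ} (ha : StrictMono a)
    (h1 : a (Fin.last m) = 1) (k : Fin m → ℝ → ℝ) : ∃ F, AgreesWith a k F := by
  classical
  refine ⟨fun x => if h : ∃ i : Fin m, x ∈ Ico (a i.castSucc) (a i.succ) then k h.choose x else 1,
    fun i x hx => ?_, ?_⟩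
  · have h : ∃ i : Fin m, x ∈ Ico (a i.castSucc) (a i.succ) := ⟨i, hx⟩
    simp only [dif_pos h]
    rw [ha.eq_of_mem_Ico_castSucc_succ h.choose_spec hx]
  · refine dif_neg ?_
    rintro ⟨i, hi⟩
    exact (h1 ▸ ha.monotone (Fin.le_last i.succ)).not_gt hi.2

section FullBranch

variable {m : ℕ} {a : Fin (m + 1) → ℝ} {k k' ψ : Fin m → ℝ → ℝ} {F : ℝ → ℝ} {A : Set ℝ}

theorem AgreesWith.preimage_inter_Ico (hF : AgreesWith a k F) (ha : StrictMono a)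
    (hψ : ∀ i, IsDiffInverse (a i.castSucc) (a i.succ) 0 1 (k i) (k' i) (ψ i))
    (hk : ∀ i, k i (a i.succ) = 1) (hA : A ⊆ Icc 0 1) (i : Fin m) :
    F ⁻¹' A ∩ Ico (a i.castSucc) (a i.succ) = ψ i '' (A \ {1}) := by
  have hle : a i.castSucc ≤ a i.succ := (ha i.castSucc_lt_succ).le
  have h1 := (hψ i).apply_one hle (hk i)
  ext y
  constructor
  · rintro ⟨hyA, hy⟩
    rw [mem_preimage, hF.1 i y hy] at hyA
    have hinv := (hψ i).invOn.1 (Ico_subset_Icc_self hy)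
    refine ⟨k i y, ⟨hyA, fun hy1 => ?_⟩, hinv⟩
    rw [mem_singleton_iff.1 hy1, h1] at hinv
    exact hy.2.ne hinv.symm
  · rintro ⟨x, ⟨hxA, hx1⟩, rfl⟩
    have hmem := (hψ i).mapsTo_inv (hA hxA)
    have hlt : ψ i x < a i.succ := by
      rw [← h1]
      exact (hψ i).strictMonoOn (hA hxA) (right_mem_Icc.2 zero_le_one)
        (lt_of_le_of_ne (hA hxA).2 hx1)
    refine ⟨?_, hmem.1, hlt⟩
    rw [mem_preimage, hF.1 i _ ⟨hmem.1, hlt⟩, (hψ i).invOn.2 (hA hxA)]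
    exact hxA

theorem AgreesWith.volume_preimage (hF : AgreesWith a k F) (ha : StrictMono a) (h0 : a 0 = 0)
    (h1 : a (Fin.last m) = 1)
    (hψ : ∀ i, IsDiffInverse (a i.castSucc) (a i.succ) 0 1 (k i) (k' i) (ψ i))
    (hk : ∀ i, k i (a i.succ) = 1) (hAm : MeasurableSet A) (hA : A ⊆ Icc 0 1) :
    volume (F ⁻¹' A ∩ Icc 0 1) = ∑ i, volume (ψ i '' (A \ {1})) := by
  have hsub : A \ {1} ⊆ Icc (0 : ℝ) 1 := sdiff_subset.trans hA
  have hIco : Ico (0 : ℝ) 1 = ⋃ i : Fin m, Ico (a i.castSucc) (a i.succ) := by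
    ext x
    simp only [mem_iUnion]
    constructor
    · exact fun hx => exists_mem_Ico_castSucc_succ (h0 ▸ hx.1) (h1 ▸ hx.2)
    · rintro ⟨i, hi⟩
      exact ⟨(h0.symm.trans_le (ha.monotone (Fin.zero_le _))).trans hi.1,
        hi.2.trans_le ((ha.monotone (Fin.le_last _)).trans_eq h1)⟩
  have hae : (F ⁻¹' A ∩ Icc 0 1 : Set ℝ) =ᵐ[volume] (F ⁻¹' A ∩ Ico 0 1 : Set ℝ) :=
    Filter.EventuallyEq.rfl.inter Ico_ae_eq_Icc.symm
  rw [measure_congr hae, hIco, inter_iUnion]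
  simp_rw [hF.preimage_inter_Ico ha hψ hk hA]
  rw [measure_iUnion, tsum_fintype]
  · intro i j hij
    simp only [Function.onFun]
    rw [← hF.preimage_inter_Ico ha hψ hk hA i, ← hF.preimage_inter_Ico ha hψ hk hA j,
      Set.disjoint_left]
    exact fun x hx hx' => hij (ha.eq_of_mem_Ico_castSucc_succ hx.2 hx'.2)
  · exact fun i => (hAm.diff (measurableSet_singleton 1)).image_of_continuousOn_injOn
      ((hψ i).continuousOn.mono hsub) ((hψ i).strictMonoOn.injOn.mono hsub)

theorem AgreesWith.preservesLeb (hF : AgreesWith a k F) (ha : StrictMono a) (h0 : a 0 = 0)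
    (h1 : a (Fin.last m) = 1)
    (hψ : ∀ i, IsDiffInverse (a i.castSucc) (a i.succ) 0 1 (k i) (k' i) (ψ i))
    (hk : ∀ i, IsBranch (a i.castSucc) (a i.succ) (k i) (k' i))
    (hsum : ∀ x ∈ Icc (0 : ℝ) 1, ∑ i, (k' i (ψ i x))⁻¹ = 1) : PreservesLeb F := by
  intro A hAm hA
  rw [hF.volume_preimage ha h0 h1 hψ (fun i => (hk i).2.2.2.2) hAm hA]
  have hsub : A \ {1} ⊆ Icc (0 : ℝ) 1 := sdiff_subset.trans hA
  have hm : MeasurableSet (A \ {1}) := hAm.diff (measurableSet_singleton 1)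
  have hpos : ∀ i, ∀ x ∈ Icc (0 : ℝ) 1, 0 < (k' i (ψ i x))⁻¹ := fun i x hx =>
    inv_pos.2 (zero_lt_one.trans ((hk i).2.2.1 _ ((hψ i).mapsTo_inv hx)))
  have hcont : ∀ i, ContinuousOn (fun x => (k' i (ψ i x))⁻¹) (Icc 0 1) := fun i =>
    ((hk i).2.1.comp (hψ i).continuousOn (hψ i).mapsTo_inv).inv₀
      fun x hx => (inv_pos.1 (hpos i x hx)).ne'
  have himage : ∀ i, volume (ψ i '' (A \ {1})) =
      ∫⁻ x in A \ {1}, ENNReal.ofReal (k' i (ψ i x))⁻¹ := fun i => by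
    rw [← setLIntegral_one, lintegral_image_eq_lintegral_abs_deriv_mul hm
      (fun x hx => ((hψ i).hasDerivWithinAt x (hsub hx)).mono hsub)
      ((hψ i).strictMonoOn.injOn.mono hsub)]
    refine setLIntegral_congr_fun hm fun x hx => ?_
    simp only [mul_one]
    rw [abs_of_pos (hpos i x (hsub hx))]
  simp_rw [himage]
  rw [← lintegral_finsetSum' _ fun i _ =>
    (((hcont i).mono hsub).aemeasurable hm).ennreal_ofReal]
  have hone : ∫⁻ x in A \ {1}, ∑ i, ENNReal.ofReal (k' i (ψ i x))⁻¹ =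
      ∫⁻ x in A \ {1}, 1 := setLIntegral_congr_fun hm fun x hx => by
    rw [← ENNReal.ofReal_sum_of_nonneg fun i _ => (hpos i x (hsub hx)).le, hsum x (hsub hx),
      ENNReal.ofReal_one]
  rw [hone, setLIntegral_one]
  exact measure_sdiff_null (measure_singleton 1)

theorem PreservesLeb.sum_inverse (hP : PreservesLeb F) (hF : AgreesWith a k F) (ha : StrictMono a)
    (h0 : a 0 = 0) (h1 : a (Fin.last m) = 1)
    (hψ : ∀ i, IsDiffInverse (a i.castSucc) (a i.succ) 0 1 (k i) (k' i) (ψ i))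
    (hk : ∀ i, IsBranch (a i.castSucc) (a i.succ) (k i) (k' i)) {t : ℝ} (ht : t ∈ Icc (0 : ℝ) 1) :
    ∑ i, (ψ i t - a i.castSucc) = t := by
  have hsub : Ico 0 t ⊆ Icc 0 1 := fun x hx => ⟨hx.1, hx.2.le.trans ht.2⟩
  have hsdiff : Ico 0 t \ {1} = Ico 0 t :=
    sdiff_singleton_eq_self fun h => ht.2.not_gt h.2
  have h := hF.volume_preimage ha h0 h1 hψ (fun i => (hk i).2.2.2.2) measurableSet_Ico hsub
  rw [hP _ measurableSet_Ico hsub, hsdiff] at h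
  have hvol : ∀ i, volume (ψ i '' Ico 0 t) = ENNReal.ofReal (ψ i t - a i.castSucc) := fun i => by
    rw [(hψ i).image_Ico ht, Real.volume_Ico,
      (hψ i).apply_zero (ha i.castSucc_lt_succ).le (hk i).2.2.2.1]
  have hnn : ∀ i, 0 ≤ ψ i t - a i.castSucc := fun i =>
    sub_nonneg.2 ((hψ i).mapsTo_inv ht).1
  simp_rw [hvol] at h
  rw [← ENNReal.ofReal_sum_of_nonneg fun i _ => hnn i, Real.volume_Ico, sub_zero,
    ENNReal.ofReal_eq_ofReal_iff ht.1 (Finset.sum_nonneg fun i _ => hnn i)] at h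
  exact h.symm

end FullBranch

/-- missing branch extension, existence and uniqueness: given C¹
expanding branches `f i` for all `i ≠ i₀` with `∑_{i ≠ i₀} 1 / fᵢ'(fᵢ⁻¹(x)) < 1`
for all `x ∈ [0,1]`, there is exactly one C¹ expanding branch on `I_{i₀}` making
the resulting full branch map preserve Lebesgue measure. -/
theorem missing_branch_extension_exists_unique (n : ℕ)
    (a : Fin (n + 3) → ℝ) (ha : StrictMono a) (ha0 : a 0 = 0)
    (haN : a (Fin.last (n + 2)) = 1)
    (i₀ : Fin (n + 2)) (f f' : Fin (n + 2) → ℝ → ℝ)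
    (hbranch : ∀ i : Fin (n + 2), i ≠ i₀ →
      IsBranch (a i.castSucc) (a i.succ) (f i) (f' i))
    (hsum : ∀ x ∈ Set.Icc (0 : ℝ) 1, ∀ y : Fin (n + 2) → ℝ,
      (∀ i, i ≠ i₀ → y i ∈ Set.Icc (a i.castSucc) (a i.succ) ∧ f i (y i) = x) →
      ∑ i ∈ Finset.univ.erase i₀, 1 / f' i (y i) < 1) :
    ∃ g g' : ℝ → ℝ,
      IsBranch (a i₀.castSucc) (a i₀.succ) g g' ∧
      (∀ F : ℝ → ℝ, AgreesWith a (Function.update f i₀ g) F → PreservesLeb F) ∧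
      ∀ h h' : ℝ → ℝ,
        IsBranch (a i₀.castSucc) (a i₀.succ) h h' →
        (∀ F : ℝ → ℝ, AgreesWith a (Function.update f i₀ h) F → PreservesLeb F) →
        Set.EqOn g h (Set.Icc (a i₀.castSucc) (a i₀.succ)) := by
  have hle : ∀ i : Fin (n + 2), a i.castSucc ≤ a i.succ := fun i => (ha i.castSucc_lt_succ).le
  have hex : ∀ i, ∃ ψ, i ≠ i₀ → IsDiffInverse (a i.castSucc) (a i.succ) 0 1 (f i) (f' i) ψ := by
    intro i
    by_cases hi : i = i₀
    · exact ⟨id, fun h => absurd hi h⟩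
    · obtain ⟨ψ, hψ⟩ := (hbranch i hi).exists_isDiffInverse (hle i)
      exact ⟨ψ, fun _ => hψ⟩
  choose ψ hψ using hex
  set S : ℝ → ℝ := fun x => ∑ i ∈ Finset.univ.erase i₀, (f' i (ψ i x))⁻¹
  set φ : ℝ → ℝ := fun x =>
    a i₀.castSucc + (x - ∑ i ∈ Finset.univ.erase i₀, (ψ i x - a i.castSucc)) with hφ
  have hpos : ∀ i, i ≠ i₀ → ∀ x ∈ Icc (0 : ℝ) 1, 0 < f' i (ψ i x) := fun i hi x hx =>
    zero_lt_one.trans ((hbranch i hi).2.2.1 _ ((hψ i hi).mapsTo_inv hx))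
  have hS_lt : ∀ x ∈ Icc (0 : ℝ) 1, S x < 1 := fun x hx => by
    simpa only [one_div] using hsum x hx (fun i => ψ i x) fun i hi =>
      ⟨(hψ i hi).mapsTo_inv hx, (hψ i hi).invOn.2 hx⟩
  have hS_pos : ∀ x ∈ Icc (0 : ℝ) 1, 0 < S x := fun x hx => by
    obtain ⟨j, hj⟩ := exists_ne i₀
    exact Finset.sum_pos (fun i hi => inv_pos.2 (hpos i (Finset.ne_of_mem_erase hi) x hx))
      ⟨j, Finset.mem_erase.2 ⟨hj, Finset.mem_univ j⟩⟩
  have hS_cont : ContinuousOn S (Icc 0 1) := continuousOn_finsetSum _ fun i hi => by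
    have hi := Finset.ne_of_mem_erase hi
    exact ((hbranch i hi).2.1.comp (hψ i hi).continuousOn (hψ i hi).mapsTo_inv).inv₀
      fun x hx => (hpos i hi x hx).ne'
  have hφ_deriv : ∀ x ∈ Icc (0 : ℝ) 1, HasDerivWithinAt φ (1 - S x) (Icc 0 1) x := fun x hx =>
    ((hasDerivWithinAt_id x _).sub (HasDerivWithinAt.fun_sum fun i hi =>
      ((hψ i (Finset.ne_of_mem_erase hi)).hasDerivWithinAt x hx).sub_const _)).const_add _
  have hφ0 : φ 0 = a i₀.castSucc := by
    have : ∑ i ∈ Finset.univ.erase i₀, (ψ i 0 - a i.castSucc) = 0 :=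
      Finset.sum_eq_zero fun i hi => by
        have hi := Finset.ne_of_mem_erase hi
        rw [(hψ i hi).apply_zero (hle i) (hbranch i hi).2.2.2.1, sub_self]
    simp only [hφ, this]
    ring
  have hφ1 : φ 1 = a i₀.succ := by
    have h : ∑ i ∈ Finset.univ.erase i₀, (ψ i 1 - a i.castSucc) =
        ∑ i ∈ Finset.univ.erase i₀, (a i.succ - a i.castSucc) :=
      Finset.sum_congr rfl fun i hi => by
        have hi := Finset.ne_of_mem_erase hi
        rw [(hψ i hi).apply_one (hle i) (hbranch i hi).2.2.2.2]
    have htotal := Fin.sum_succ_sub_castSucc a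
    rw [← Finset.add_sum_erase _ _ (Finset.mem_univ i₀), ha0, haN] at htotal
    simp only [hφ, h]
    linarith
  obtain ⟨g, hg⟩ := exists_isDiffInverse zero_le_one hφ_deriv
    fun x hx => sub_pos.2 (hS_lt x hx)
  rw [hφ0, hφ1] at hg
  set g' : ℝ → ℝ := fun y => (1 - S (g y))⁻¹ with hg'
  have hgb : IsBranch (a i₀.castSucc) (a i₀.succ) g g' := by
    refine ⟨hg.hasDerivWithinAt, ?_, fun y hy => ?_, ?_, ?_⟩
    · exact (continuousOn_const.sub (hS_cont.comp hg.continuousOn hg.mapsTo_inv)).inv₀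
        fun y hy => (sub_pos.2 (hS_lt _ (hg.mapsTo_inv hy))).ne'
    · have hy := hg.mapsTo_inv hy
      exact (one_lt_inv₀ (sub_pos.2 (hS_lt _ hy))).2 (sub_lt_self _ (hS_pos _ hy))
    · rw [← hφ0]
      exact hg.invOn.1 (left_mem_Icc.2 zero_le_one)
    · rw [← hφ1]
      exact hg.invOn.1 (right_mem_Icc.2 zero_le_one)
  have hbranch_update : ∀ h h' : ℝ → ℝ, IsBranch (a i₀.castSucc) (a i₀.succ) h h' →
      ∀ i, IsBranch (a i.castSucc) (a i.succ) (Function.update f i₀ h i)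
        (Function.update f' i₀ h' i) := fun h h' hh i => by
    by_cases hi : i = i₀
    · subst hi
      simpa using hh
    · simpa [hi] using hbranch i hi
  have hinverse_update : ∀ h h' χ : ℝ → ℝ,
      IsDiffInverse (a i₀.castSucc) (a i₀.succ) 0 1 h h' χ →
      ∀ i, IsDiffInverse (a i.castSucc) (a i.succ) 0 1 (Function.update f i₀ h i)
        (Function.update f' i₀ h' i) (Function.update ψ i₀ χ i) := fun h h' χ hχ i => by
    by_cases hi : i = i₀
    · subst hi
      simpa using hχ
    · simpa [hi] using hψ i hi
  refine ⟨g, g', hgb, fun F hF => ?_, fun h h' hh hP => ?_⟩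
  · obtain ⟨χ, hχ⟩ := hgb.exists_isDiffInverse (hle i₀)
    refine hF.preservesLeb ha ha0 haN (hinverse_update g g' χ hχ) (hbranch_update g g' hgb)
      fun x hx => ?_
    have herase : ∑ i ∈ Finset.univ.erase i₀,
        (Function.update f' i₀ g' i (Function.update ψ i₀ χ i x))⁻¹ = S x :=
      Finset.sum_congr rfl fun i hi => by
        simp [Finset.ne_of_mem_erase hi]
    rw [← Finset.add_sum_erase _ _ (Finset.mem_univ i₀), herase]
    simp [hg', hχ.invOn.2 hx]
  · obtain ⟨χ, hχ⟩ := hh.exists_isDiffInverse (hle i₀)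
    obtain ⟨F, hF⟩ := exists_agreesWith ha haN (Function.update f i₀ h)
    have hχφ : ∀ t ∈ Icc (0 : ℝ) 1, χ t = φ t := fun t ht => by
      have hsum_t := (hP F hF).sum_inverse hF ha ha0 haN (hinverse_update h h' χ hχ)
        (hbranch_update h h' hh) ht
      have herase : ∑ i ∈ Finset.univ.erase i₀, (Function.update ψ i₀ χ i t - a i.castSucc) =
          ∑ i ∈ Finset.univ.erase i₀, (ψ i t - a i.castSucc) :=
        Finset.sum_congr rfl fun i hi => by
          simp [Finset.ne_of_mem_erase hi]
      rw [← Finset.add_sum_erase _ _ (Finset.mem_univ i₀), herase, Function.update_self] at hsum_t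
      simp only [hφ]
      linarith
    intro y hy
    have hφy : φ (h y) = y := by
      rw [← hχφ _ (hχ.mapsTo hy)]
      exact hχ.invOn.1 hy
    rw [← hφy, hg.invOn.1 (hχ.mapsTo hy), hφy]
end

section
/- Missing branch extension (necessity): let 1 ≤ i₀ ≤ n and suppose C¹ expanding branches f_i on I_i are given for all i ≠ i₀. If there exists a C¹ expanding branch f_{i₀} on I_{i₀} such that the full branch map defined by f₁, …, fₙ preserves Lebesgue measure, then Σ_{i≠i₀} 1/(f_i'(f_i⁻¹(x))) < 1 for every x ∈ [0,1]. -/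
open Set MeasureTheory

open Filter Topology

theorem IsBranch.strictMonoOn {l r : ℝ} {g g' : ℝ → ℝ} (h : IsBranch l r g g') :
    StrictMonoOn g (Set.Icc l r) := by
  refine strictMonoOn_of_hasDerivWithinAt_pos (convex_Icc l r)
    (fun x hx => (h.1 x hx).continuousWithinAt)
    (fun x hx => (h.1 x (interior_subset hx)).mono interior_subset)
    (fun x hx => one_pos.trans (h.2.2.1 x (interior_subset hx)))

/-- Near a point `y`, a branch expands distances by at most any factor `c > g' y`. -/
theorem IsBranch.exists_abs_sub_le {l r : ℝ} {g g' : ℝ → ℝ} (h : IsBranch l r g g')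
    {y c : ℝ} (hy : y ∈ Set.Icc l r) (hc : g' y < c) :
    ∃ δ > 0, ∀ t ∈ Set.Icc l r, |t - y| < δ → |g t - g y| ≤ c * |t - y| := by
  obtain ⟨δ, hδ, hsub⟩ := Metric.mem_nhdsWithin_iff.1 ((h.1 y hy).limsup_slope_le hc)
  refine ⟨δ, hδ, fun t ht htδ => ?_⟩
  rcases eq_or_ne t y with rfl | hne
  · simp
  have hs : slope g y t < c := hsub ⟨by simpa [Real.dist_eq] using htδ, ht, hne⟩
  rw [slope_def_field] at hs
  rcases lt_or_gt_of_ne hne with hlt | hgt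
  · have hm := h.strictMonoOn ht hy hlt
    rw [div_lt_iff_of_neg (by linarith)] at hs
    rw [abs_of_neg (by linarith), abs_of_neg (by linarith)]
    linarith
  · have hm := h.strictMonoOn hy ht hgt
    rw [div_lt_iff₀ (by linarith)] at hs
    rw [abs_of_pos (by linarith), abs_of_pos (by linarith)]
    linarith

theorem IsBranch.eventually_Ico_subset_right {l r : ℝ} {g g' : ℝ → ℝ} (h : IsBranch l r g g')
    {y c : ℝ} (hy : y ∈ Set.Icc l r) (hc : g' y < c) (hlt : g y < 1) :
    ∀ᶠ ε in 𝓝[>] (0 : ℝ), ∃ u, Set.Ico u (u + ε / c) ⊆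
      Set.Ico l r ∩ g ⁻¹' Set.Icc (g y) (g y + ε) := by
  have hc0 : 0 < c := by linarith [h.2.2.1 y hy]
  have hyr : y < r := lt_of_le_of_ne hy.2 (by rintro rfl; linarith [h.2.2.2.2])
  obtain ⟨δ, hδ, hb⟩ := h.exists_abs_sub_le hy hc
  have hpos : 0 < min δ (r - y) * c := mul_pos (lt_min hδ (by linarith)) hc0
  filter_upwards [Ioo_mem_nhdsGT hpos] with ε hε
  have hm : ε / c < min δ (r - y) := (div_lt_iff₀ hc0).2 hε.2
  have h1 := hm.trans_le (min_le_left _ _)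
  have h2 := hm.trans_le (min_le_right _ _)
  refine ⟨y, fun t ht => ?_⟩
  have htm : t ∈ Set.Icc l r := ⟨hy.1.trans ht.1, by linarith [ht.2]⟩
  have hmon := h.strictMonoOn.monotoneOn hy htm ht.1
  have hab : |t - y| = t - y := abs_of_nonneg (by linarith [ht.1])
  have hd := (le_abs_self _).trans (hb t htm (by rw [hab]; linarith [ht.2]))
  have hle : (t - y) * c ≤ ε := (le_div_iff₀ hc0).1 (by linarith [ht.2])
  rw [hab] at hd
  exact ⟨⟨htm.1, by linarith [ht.2]⟩, hmon, by linarith⟩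

theorem IsBranch.eventually_Ico_subset_left {l r : ℝ} {g g' : ℝ → ℝ} (h : IsBranch l r g g')
    {y c : ℝ} (hy : y ∈ Set.Icc l r) (hc : g' y < c) (hlt : 0 < g y) :
    ∀ᶠ ε in 𝓝[>] (0 : ℝ), ∃ u, Set.Ico u (u + ε / c) ⊆
      Set.Ico l r ∩ g ⁻¹' Set.Icc (g y - ε) (g y) := by
  have hc0 : 0 < c := by linarith [h.2.2.1 y hy]
  have hly : l < y := lt_of_le_of_ne hy.1 (by rintro rfl; linarith [h.2.2.2.1])
  obtain ⟨δ, hδ, hb⟩ := h.exists_abs_sub_le hy hc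
  have hpos : 0 < min δ (y - l) * c := mul_pos (lt_min hδ (by linarith)) hc0
  filter_upwards [Ioo_mem_nhdsGT hpos] with ε hε
  have hm : ε / c < min δ (y - l) := (div_lt_iff₀ hc0).2 hε.2
  have h1 := hm.trans_le (min_le_left _ _)
  have h2 := hm.trans_le (min_le_right _ _)
  refine ⟨y - ε / c, fun t ht => ?_⟩
  have hty : t < y := by linarith [ht.2]
  have htm : t ∈ Set.Icc l r := ⟨by linarith [ht.1], hty.le.trans hy.2⟩
  have hmon := h.strictMonoOn.monotoneOn htm hy hty.le
  have hab : |t - y| = y - t := by rw [abs_sub_comm]; exact abs_of_pos (by linarith)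
  have hd := (neg_le_abs _).trans (hb t htm (by rw [hab]; linarith [ht.1]))
  have hle : (y - t) * c ≤ ε := (le_div_iff₀ hc0).1 (by linarith [ht.1])
  rw [hab] at hd
  exact ⟨⟨htm.1, hty.trans_le hy.2⟩, by linarith, hmon⟩

theorem pairwise_disjoint_Ico_castSucc_succ {m : ℕ} {a : Fin (m + 1) → ℝ} (ha : Monotone a) :
    Pairwise (Function.onFun Disjoint fun i : Fin m => Set.Ico (a i.castSucc) (a i.succ)) := by
  refine (pairwise_disjoint_on _).2 fun i j hij => Set.disjoint_left.2 fun t hi hj => ?_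
  have hle : a i.succ ≤ a j.castSucc := ha (Fin.succ_le_castSucc_iff.2 hij)
  linarith [hi.2, hj.1]

/-- If each branch maps an interval of length `ℓ i` into a set `J`, then preservation of
Lebesgue measure bounds the total length by the measure of `J`. -/
theorem PreservesLeb.sum_length_le {m : ℕ} {a : Fin (m + 1) → ℝ} (ha : Monotone a)
    (ha0 : a 0 = 0) (ha1 : a (Fin.last m) = 1) {h : Fin m → ℝ → ℝ} {F : ℝ → ℝ}
    (hF : AgreesWith a h F) (hpres : PreservesLeb F) {p q : ℝ} (hp : 0 ≤ p) (hpq : p ≤ q)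
    (hq : q ≤ 1) {u ℓ : Fin m → ℝ} (hℓ : ∀ i, 0 ≤ ℓ i)
    (hu : ∀ i, Set.Ico (u i) (u i + ℓ i) ⊆
      Set.Ico (a i.castSucc) (a i.succ) ∩ h i ⁻¹' Set.Icc p q) :
    ∑ i, ℓ i ≤ q - p := by
  have hdisj : Pairwise (Function.onFun Disjoint fun i => Set.Ico (u i) (u i + ℓ i)) :=
    fun i j hij => (pairwise_disjoint_Ico_castSucc_succ ha hij).mono
      ((hu i).trans Set.inter_subset_left) ((hu j).trans Set.inter_subset_left)
  have hsub : (⋃ i, Set.Ico (u i) (u i + ℓ i)) ⊆ F ⁻¹' Set.Icc p q ∩ Set.Icc 0 1 := by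
    refine Set.iUnion_subset fun i t ht => ?_
    obtain ⟨hI, hJ⟩ := hu i ht
    refine ⟨?_, ?_, ?_⟩
    · rw [Set.mem_preimage, hF.1 i t hI]
      exact hJ
    · exact ha0 ▸ (ha (Fin.zero_le _)).trans hI.1
    · exact ha1 ▸ hI.2.le.trans (ha (Fin.le_last _))
  have hvol := measure_mono (μ := volume) hsub
  rw [hpres _ measurableSet_Icc (Set.Icc_subset_Icc hp hq),
    measure_iUnion hdisj fun _ => measurableSet_Ico, tsum_fintype] at hvol
  simp only [Real.volume_Ico, Real.volume_Icc, add_sub_cancel_left] at hvol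
  rw [← ENNReal.ofReal_sum_of_nonneg fun i _ => hℓ i] at hvol
  exact (ENNReal.ofReal_le_ofReal_iff (by linarith)).1 hvol

/-- The transfer operator of a measure-preserving full branch map sends `1` to a function
that is at most `1` everywhere. -/
theorem PreservesLeb.sum_inv_deriv_le_one {m : ℕ} {a : Fin (m + 1) → ℝ} (ha : Monotone a)
    (ha0 : a 0 = 0) (ha1 : a (Fin.last m) = 1) {h h' : Fin m → ℝ → ℝ} {F : ℝ → ℝ}
    (hbranch : ∀ i, IsBranch (a i.castSucc) (a i.succ) (h i) (h' i))
    (hF : AgreesWith a h F) (hpres : PreservesLeb F) {x : ℝ} (hx : x ∈ Set.Icc (0 : ℝ) 1)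
    {y : Fin m → ℝ} (hy : ∀ i, y i ∈ Set.Icc (a i.castSucc) (a i.succ))
    (hxy : ∀ i, h i (y i) = x) :
    ∑ i, 1 / h' i (y i) ≤ 1 := by
  have hpos : ∀ i, 0 < h' i (y i) := fun i => one_pos.trans ((hbranch i).2.2.1 _ (hy i))
  have hlim : Tendsto (fun η : ℝ => ∑ i, 1 / (h' i (y i) + η)) (𝓝[>] 0)
      (𝓝 (∑ i, 1 / h' i (y i))) := by
    refine tendsto_finsetSum _ fun i _ => ?_
    have hadd : Tendsto (fun η : ℝ => h' i (y i) + η) (𝓝[>] 0) (𝓝 (h' i (y i) + 0)) :=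
      tendsto_const_nhds.add (tendsto_id.mono_left nhdsWithin_le_nhds)
    rw [add_zero] at hadd
    exact tendsto_const_nhds.div hadd (hpos i).ne'
  refine le_of_tendsto hlim ?_
  filter_upwards [self_mem_nhdsWithin] with η hη
  have hη : 0 < η := hη
  have hc : ∀ i, h' i (y i) < h' i (y i) + η := fun i => by linarith
  suffices hε : ∃ ε > 0, ∑ i, ε / (h' i (y i) + η) ≤ ε by
    obtain ⟨ε, hε, hle⟩ := hε
    refine le_of_mul_le_mul_left ?_ hε
    simpa [Finset.mul_sum, div_eq_mul_inv] using hle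
  rcases hx.2.lt_or_eq with hlt | rfl
  · have hev := eventually_all.2 fun i =>
      (hbranch i).eventually_Ico_subset_right (hy i) (hc i) ((hxy i).trans_lt hlt)
    obtain ⟨ε, hu, hε⟩ := (hev.and (Ioo_mem_nhdsGT (sub_pos.2 hlt))).exists
    choose u hu using hu
    refine ⟨ε, hε.1, ?_⟩
    have hle := hpres.sum_length_le ha ha0 ha1 hF (p := x) (q := x + ε) (u := u) hx.1
      (by linarith [hε.1]) (by linarith [hε.2])
      (fun i => (div_pos hε.1 ((hpos i).trans (hc i))).le) (fun i => by simpa [hxy i] using hu i)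
    linarith
  · have hev := eventually_all.2 fun i =>
      (hbranch i).eventually_Ico_subset_left (hy i) (hc i) (by simp [hxy i])
    obtain ⟨ε, hu, hε⟩ := (hev.and (Ioo_mem_nhdsGT one_pos)).exists
    choose u hu using hu
    refine ⟨ε, hε.1, ?_⟩
    have hle := hpres.sum_length_le ha ha0 ha1 hF (p := 1 - ε) (q := 1) (u := u)
      (by linarith [hε.2]) (by linarith [hε.1]) le_rfl
      (fun i => (div_pos hε.1 ((hpos i).trans (hc i))).le) (fun i => by simpa [hxy i] using hu i)
    linarith

/-- missing branch extension, necessity: if some C¹ expanding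
branch `g` on `I_{i₀}` completes the given branches `f i` (`i ≠ i₀`) to a full
branch map preserving Lebesgue measure, then `∑_{i ≠ i₀} 1 / fᵢ'(fᵢ⁻¹(x)) < 1`
for every `x ∈ [0,1]`. -/
theorem missing_branch_extension_necessity (n : ℕ)
    (a : Fin (n + 3) → ℝ) (ha : StrictMono a) (ha0 : a 0 = 0)
    (haN : a (Fin.last (n + 2)) = 1)
    (i₀ : Fin (n + 2)) (f f' : Fin (n + 2) → ℝ → ℝ)
    (hbranch : ∀ i : Fin (n + 2), i ≠ i₀ →
      IsBranch (a i.castSucc) (a i.succ) (f i) (f' i))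
    (g g' : ℝ → ℝ)
    (hg : IsBranch (a i₀.castSucc) (a i₀.succ) g g')
    (F : ℝ → ℝ) (hF : AgreesWith a (Function.update f i₀ g) F)
    (hpres : PreservesLeb F) :
    ∀ x ∈ Set.Icc (0 : ℝ) 1, ∀ y : Fin (n + 2) → ℝ,
      (∀ i, i ≠ i₀ → y i ∈ Set.Icc (a i.castSucc) (a i.succ) ∧ f i (y i) = x) →
      ∑ i ∈ Finset.univ.erase i₀, 1 / f' i (y i) < 1 := by
  intro x hx y hy
  obtain ⟨z, hz, hgz⟩ : x ∈ g '' Set.Icc (a i₀.castSucc) (a i₀.succ) := by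
    refine intermediate_value_Icc (ha Fin.castSucc_lt_succ).le
      (fun t ht => (hg.1 t ht).continuousWithinAt) ?_
    rwa [hg.2.2.2.1, hg.2.2.2.2]
  have hupd : ∀ i, IsBranch (a i.castSucc) (a i.succ) (Function.update f i₀ g i)
      (Function.update f' i₀ g' i) ∧
      Function.update y i₀ z i ∈ Set.Icc (a i.castSucc) (a i.succ) ∧
      Function.update f i₀ g i (Function.update y i₀ z i) = x := by
    intro i
    rcases eq_or_ne i i₀ with rfl | hi
    · simpa using ⟨hg, hz, hgz⟩
    · simpa [hi] using ⟨hbranch i hi, hy i hi⟩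
  have hsum := hpres.sum_inv_deriv_le_one ha.monotone ha0 haN (fun i => (hupd i).1) hF hx
    (fun i => (hupd i).2.1) (fun i => (hupd i).2.2)
  rw [← Finset.sum_erase_add _ _ (Finset.mem_univ i₀)] at hsum
  have hcongr : ∑ i ∈ Finset.univ.erase i₀,
      1 / Function.update f' i₀ g' i (Function.update y i₀ z i) =
      ∑ i ∈ Finset.univ.erase i₀, 1 / f' i (y i) :=
    Finset.sum_congr rfl fun i hi => by simp [Finset.ne_of_mem_erase hi]
  have hgpos : 0 < 1 / g' z := one_div_pos.2 (one_pos.trans (hg.2.2.1 z hz))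
  rw [hcongr] at hsum
  simp only [Function.update_self] at hsum
  linarith
end

section
/- Perturbed maps have unbounded distortion: let f̃ be a full branch map with C¹ expanding branches f̃₁, …, f̃ₙ which preserves Lebesgue measure, and suppose there are constants 1 < λ₀ ≤ σ with λ₀ ≤ f̃_i'(x) ≤ σ for every branch i and every x ∈ I_i. Suppose there exist δ ∈ (0, a₁], ε > 0, a function g : [0, δ] → ℝ admitting a Dini-integrable modulus of continuity, and a modulus of continuity ω with ω(t) > 0 for t ∈ (0,1] and ∫₀¹ ω(t)/t dt = ∞, such that f̃₁'(x) = g(x) + ε ω(x) for all x ∈ [0, δ]. Then f̃ has unbounded distortion. -/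
open Set MeasureTheory

/-- `w` is a modulus of continuity: continuous, nondecreasing, concave and
nonnegative on `[0,1]` with `w 0 = 0`. -/
def IsModulus (w : ℝ → ℝ) : Prop :=
  ContinuousOn w (Set.Icc 0 1) ∧ MonotoneOn w (Set.Icc 0 1) ∧
  ConcaveOn ℝ (Set.Icc 0 1) w ∧ (∀ t ∈ Set.Icc (0 : ℝ) 1, 0 ≤ w t) ∧ w 0 = 0

/-- The full branch map with branches `f i` (and branch derivatives `f' i`) has
unbounded distortion: the log-ratios of derivatives of iterates over pairs of
points in a common level-`k` cylinder (encoded by an itinerary `j` and orbits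
`u`, `v` following it) are unbounded. -/
def UnboundedDistortionFB {n : ℕ} (a : Fin (n + 1) → ℝ)
    (f f' : Fin n → ℝ → ℝ) : Prop :=
  ∀ M : ℝ, ∃ k : ℕ, 1 ≤ k ∧ ∃ j : ℕ → Fin n, ∃ u v : ℕ → ℝ,
    (∀ l < k, u l ∈ Set.Icc (a (j l).castSucc) (a (j l).succ) ∧
      f (j l) (u l) = u (l + 1)) ∧
    (∀ l < k, v l ∈ Set.Icc (a (j l).castSucc) (a (j l).succ) ∧
      f (j l) (v l) = v (l + 1)) ∧
    M < Real.log (∏ l ∈ Finset.range k, f' (j l) (u l)) -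
        Real.log (∏ l ∈ Finset.range k, f' (j l) (v l))

lemma geometric_Ioc_volume {δ q : ℝ} (m : ℕ) :
    volume (Ioc (δ * q ^ (m + 1)) (δ * q ^ m)) = ENNReal.ofReal (δ * q ^ m * (1 - q)) := by
  rw [Real.volume_Ioc]
  congr 1
  ring

lemma geometric_mem_Icc {δ q : ℝ} (hδ : 0 < δ) (hδ1 : δ ≤ 1) (hq : 0 < q) (hq1 : q < 1) (m : ℕ) :
    δ * q ^ m ∈ Icc (0 : ℝ) 1 :=
  ⟨by positivity, mul_le_one₀ hδ1 (by positivity) (pow_le_one₀ hq.le hq1.le)⟩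

/-- A Dini-integrable modulus is summable along geometric sequences. -/
lemma IsModulus.summable_geometric {w : ℝ → ℝ} (hw : IsModulus w)
    (hD : ∫⁻ t in Ioc (0 : ℝ) 1, ENNReal.ofReal (w t / t) < ⊤)
    {δ q : ℝ} (hδ : 0 < δ) (hδ1 : δ ≤ 1) (hq : 0 < q) (hq1 : q < 1) :
    Summable fun m : ℕ ↦ w (δ * q ^ (m + 1)) := by
  obtain ⟨-, hmono, -, hpos, -⟩ := hw
  have hmem := geometric_mem_Icc hδ hδ1 hq hq1
  have h1q : 0 < 1 - q := sub_pos.2 hq1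
  have hanti : Antitone fun m : ℕ ↦ δ * q ^ m := fun i j hij ↦
    mul_le_mul_of_nonneg_left (pow_le_pow_of_le_one hq.le hq1.le hij) hδ.le
  have hdisj : Pairwise (Function.onFun Disjoint
      fun m : ℕ ↦ Ioc (δ * q ^ (m + 1)) (δ * q ^ m)) := by
    simpa using hanti.pairwise_disjoint_on_Ioc_succ
  have hle : ∑' m : ℕ, ENNReal.ofReal (w (δ * q ^ (m + 1)) * (1 - q)) < ⊤ := by
    refine lt_of_le_of_lt ?_ hD
    calc ∑' m : ℕ, ENNReal.ofReal (w (δ * q ^ (m + 1)) * (1 - q))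
        ≤ ∑' m : ℕ, ∫⁻ t in Ioc (δ * q ^ (m + 1)) (δ * q ^ m), ENNReal.ofReal (w t / t) := by
          refine ENNReal.tsum_le_tsum fun m ↦ ?_
          have hp : 0 < δ * q ^ m := by positivity
          calc ENNReal.ofReal (w (δ * q ^ (m + 1)) * (1 - q))
              = ENNReal.ofReal (w (δ * q ^ (m + 1)) / (δ * q ^ m)) *
                  volume (Ioc (δ * q ^ (m + 1)) (δ * q ^ m)) := by
                rw [geometric_Ioc_volume, ← ENNReal.ofReal_mul
                  (div_nonneg (hpos _ (hmem _)) hp.le)]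
                congr 1
                field_simp
            _ ≤ _ := by
                rw [← setLIntegral_const]
                refine setLIntegral_mono' measurableSet_Ioc fun t ht ↦ ?_
                have ht0 : 0 < t := lt_of_le_of_lt (hmem (m + 1)).1 ht.1
                have htm : t ∈ Icc (0 : ℝ) 1 := ⟨ht0.le, ht.2.trans (hmem m).2⟩
                exact ENNReal.ofReal_le_ofReal (div_le_div₀ (hpos t htm)
                  (hmono (hmem _) htm ht.1.le) ht0 ht.2)
      _ = ∫⁻ t in ⋃ m : ℕ, Ioc (δ * q ^ (m + 1)) (δ * q ^ m), ENNReal.ofReal (w t / t) :=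
          (lintegral_iUnion (fun _ ↦ measurableSet_Ioc) hdisj _).symm
      _ ≤ _ := lintegral_mono_set <| iUnion_subset fun m ↦
          Ioc_subset_Ioc (hmem (m + 1)).1 (hmem m).2
  have hs : Summable fun m : ℕ ↦ w (δ * q ^ (m + 1)) * (1 - q) := by
    refine (ENNReal.summable_toReal hle.ne).congr fun m ↦ ?_
    exact ENNReal.toReal_ofReal (mul_nonneg (hpos _ (hmem _)) h1q.le)
  exact (summable_mul_right_iff h1q.ne').1 hs

/-- A modulus which is not Dini-integrable is not summable along geometric sequences. -/
lemma IsModulus.not_summable_geometric {w : ℝ → ℝ} (hw : IsModulus w)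
    (hD : ∫⁻ t in Ioc (0 : ℝ) 1, ENNReal.ofReal (w t / t) = ⊤)
    {δ q : ℝ} (hδ : 0 < δ) (hδ1 : δ ≤ 1) (hq : 0 < q) (hq1 : q < 1) :
    ¬ Summable fun m : ℕ ↦ w (δ * q ^ (m + 1)) := by
  intro hs
  obtain ⟨-, hmono, -, hpos, -⟩ := hw
  have hmem := geometric_mem_Icc hδ hδ1 hq hq1
  have h1q : 0 < 1 - q := sub_pos.2 hq1
  have hs' : Summable fun m : ℕ ↦ w (δ * q ^ m) * ((1 - q) / q) :=
    ((summable_nat_add_iff (f := fun m : ℕ ↦ w (δ * q ^ m)) 1).1 hs).mul_right _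
  have hcover : Ioc (0 : ℝ) 1 ⊆
      (⋃ m : ℕ, Ioc (δ * q ^ (m + 1)) (δ * q ^ m)) ∪ Ioc δ 1 := by
    intro t ht
    rcases le_or_gt t δ with h | h
    · obtain ⟨m, h1, h2⟩ := exists_nat_pow_near_of_lt_one (div_pos ht.1 hδ)
        ((div_le_one hδ).2 h) hq hq1
      exact Or.inl (mem_iUnion.2 ⟨m, by rwa [lt_div_iff₀' hδ] at h1, by
        rwa [div_le_iff₀' hδ] at h2⟩)
    · exact Or.inr ⟨h, ht.2⟩
  have hsmall : ∫⁻ t in ⋃ m : ℕ, Ioc (δ * q ^ (m + 1)) (δ * q ^ m),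
      ENNReal.ofReal (w t / t) < ⊤ := by
    refine lt_of_le_of_lt (lintegral_iUnion_le _ _) ?_
    refine lt_of_le_of_lt (ENNReal.tsum_le_tsum fun m ↦ ?_) hs'.tsum_ofReal_lt_top
    have hp : 0 < δ * q ^ (m + 1) := by positivity
    calc ∫⁻ t in Ioc (δ * q ^ (m + 1)) (δ * q ^ m), ENNReal.ofReal (w t / t)
        ≤ ∫⁻ _ in Ioc (δ * q ^ (m + 1)) (δ * q ^ m),
            ENNReal.ofReal (w (δ * q ^ m) / (δ * q ^ (m + 1))) := by
          refine setLIntegral_mono' measurableSet_Ioc fun t ht ↦ ?_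
          have htm : t ∈ Icc (0 : ℝ) 1 := ⟨(hp.trans ht.1).le, ht.2.trans (hmem m).2⟩
          exact ENNReal.ofReal_le_ofReal (div_le_div₀ (hpos _ (hmem m))
            (hmono htm (hmem m) ht.2) hp ht.1.le)
      _ = ENNReal.ofReal (w (δ * q ^ m) * ((1 - q) / q)) := by
          rw [setLIntegral_const, geometric_Ioc_volume, ← ENNReal.ofReal_mul
            (div_nonneg (hpos _ (hmem _)) hp.le)]
          congr 1
          field_simp
          ring
  have hlarge : ∫⁻ t in Ioc δ 1, ENNReal.ofReal (w t / t) < ⊤ := by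
    calc ∫⁻ t in Ioc δ 1, ENNReal.ofReal (w t / t)
        ≤ ∫⁻ _ in Ioc δ 1, ENNReal.ofReal (w 1 / δ) := by
          refine setLIntegral_mono' measurableSet_Ioc fun t ht ↦ ?_
          have h1 : (1 : ℝ) ∈ Icc (0 : ℝ) 1 := ⟨zero_le_one, le_rfl⟩
          exact ENNReal.ofReal_le_ofReal (div_le_div₀ (hpos _ h1)
            (hmono ⟨(hδ.trans ht.1).le, ht.2⟩ h1 ht.2) hδ ht.1.le)
      _ < ⊤ := by
          rw [setLIntegral_const, Real.volume_Ioc]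
          exact ENNReal.mul_lt_top ENNReal.ofReal_lt_top ENNReal.ofReal_lt_top
  exact (((lintegral_mono_set hcover).trans (lintegral_union_le _ _ _)).trans_lt
    (ENNReal.add_lt_top.2 ⟨hsmall, hlarge⟩)).ne hD

/-- A branch over `[0, r]` with derivative in `[lam, sig]` has an inverse contracting distances
to the fixed point `0` by factors between `sig⁻¹` and `lam⁻¹`. -/
lemma IsBranch.exists_inverse {r lam sig : ℝ} {g g' : ℝ → ℝ} (hr : 0 ≤ r)
    (hg : IsBranch 0 r g g') (hlam : 0 < lam)
    (hbound : ∀ x ∈ Icc 0 r, lam ≤ g' x ∧ g' x ≤ sig) {y : ℝ} (hy : y ∈ Icc (0 : ℝ) 1) :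
    ∃ x ∈ Icc 0 r, g x = y ∧ y * sig⁻¹ ≤ x ∧ x ≤ y * lam⁻¹ := by
  obtain ⟨hd, -, -, h0, h1⟩ := hg
  have hcont : ContinuousOn g (Icc 0 r) := fun x hx ↦ (hd x hx).continuousWithinAt
  have hsig : 0 < sig := by
    have := hbound 0 ⟨le_rfl, hr⟩
    linarith
  obtain ⟨x, hx, rfl⟩ := intermediate_value_Icc hr hcont (by rwa [h0, h1])
  refine ⟨x, hx, rfl, ?_⟩
  rw [← div_eq_mul_inv, ← div_eq_mul_inv, div_le_iff₀ hsig, le_div_iff₀ hlam]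
  rcases hx.1.eq_or_lt with rfl | hx0
  · simp [h0]
  · obtain ⟨c, hc, hslope⟩ := exists_hasDerivAt_eq_slope g g' hx0
      (hcont.mono (Icc_subset_Icc_right hx.2)) fun c hc ↦
        (hd c ⟨hc.1.le, hc.2.le.trans hx.2⟩).hasDerivAt
          (Icc_mem_nhds hc.1 (hc.2.trans_le hx.2))
    rw [h0, sub_zero, sub_zero, eq_div_iff hx0.ne'] at hslope
    obtain ⟨hl, hu⟩ := hbound c ⟨hc.1.le, hc.2.le.trans hx.2⟩
    rw [← hslope, mul_comm x, mul_comm x]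
    exact ⟨mul_le_mul_of_nonneg_right hu hx0.le, mul_le_mul_of_nonneg_right hl hx0.le⟩

lemma sub_div_le_log_sub_log {x y : ℝ} (hx : 0 < x) (hy : 0 < y) :
    (x - y) / x ≤ Real.log x - Real.log y := by
  have h := Real.one_sub_inv_le_log_of_pos (div_pos hx hy)
  rw [Real.log_div hx.ne' hy.ne', inv_div] at h
  rwa [sub_div, div_self hx.ne']

/-- Backward orbits of `δ` under the branch fixing `0`. -/
lemma IsBranch.exists_backward_orbit {r lam sig δ : ℝ} {g g' : ℝ → ℝ}
    (hg : IsBranch 0 r g g') (hlam : 1 < lam)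
    (hbound : ∀ x ∈ Icc 0 r, lam ≤ g' x ∧ g' x ≤ sig)
    (hδ : 0 < δ) (hδr : δ ≤ r) (hr1 : r ≤ 1) :
    ∃ x : ℕ → ℝ, ∀ m, x m ∈ Icc 0 δ ∧ g (x (m + 1)) = x m ∧
      δ * sig⁻¹ ^ m ≤ x m ∧ x m ≤ δ * lam⁻¹ ^ m := by
  have hlam0 : 0 < lam := zero_lt_one.trans hlam
  have hinv : ∀ y : ℝ, ∃ x, y ∈ Icc (0 : ℝ) 1 →
      x ∈ Icc 0 r ∧ g x = y ∧ y * sig⁻¹ ≤ x ∧ x ≤ y * lam⁻¹ := by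
    intro y
    by_cases hy : y ∈ Icc (0 : ℝ) 1
    · obtain ⟨x, h⟩ := hg.exists_inverse (hδ.le.trans hδr) hlam0 hbound hy
      exact ⟨x, fun _ ↦ h⟩
    · exact ⟨0, fun h ↦ absurd h hy⟩
  choose h hh using hinv
  have hsig : 0 < sig := by
    have := hbound 0 ⟨le_rfl, hδ.le.trans hδr⟩
    linarith
  have key : ∀ m, h^[m] δ ∈ Icc 0 δ ∧ δ * sig⁻¹ ^ m ≤ h^[m] δ ∧ h^[m] δ ≤ δ * lam⁻¹ ^ m := by
    intro m
    induction m with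
    | zero => simp [hδ.le]
    | succ m ih =>
      obtain ⟨hm, hl, hu⟩ := ih
      obtain ⟨hmem, -, hl', hu'⟩ := hh _ ⟨hm.1, hm.2.trans (hδr.trans hr1)⟩
      rw [Function.iterate_succ_apply']
      refine ⟨⟨hmem.1, hu'.trans ((mul_le_of_le_one_right hm.1 ?_).trans hm.2)⟩, ?_, ?_⟩
      · exact inv_le_one_of_one_le₀ hlam.le
      · refine le_trans ?_ hl'
        rw [pow_succ, ← mul_assoc]
        gcongr
      · refine hu'.trans ?_
        rw [pow_succ, ← mul_assoc]
        gcongr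
  refine ⟨fun m ↦ h^[m] δ, fun m ↦ ⟨(key m).1, ?_, (key m).2⟩⟩
  simp only [Function.iterate_succ_apply']
  exact (hh _ ⟨(key m).1.1, (key m).1.2.trans (hδr.trans hr1)⟩).2.1

/-- perturbed maps have unbounded distortion: a Lebesgue-measure
preserving full branch map with C¹ expanding branches whose derivatives lie in
`[λ₀, σ] ⊆ (1, ∞)`, and whose first branch derivative on some `[0, δ]` equals
`g + ε ω` with `g` admitting a Dini-integrable modulus of continuity and `ω` a
positive non-Dini-integrable modulus of continuity, has unbounded distortion. -/
theorem perturbed_map_unbounded_distortion (n : ℕ)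
    (a : Fin (n + 3) → ℝ) (ha : StrictMono a) (ha0 : a 0 = 0)
    (haN : a (Fin.last (n + 2)) = 1)
    (f f' : Fin (n + 2) → ℝ → ℝ)
    (hbranch : ∀ i : Fin (n + 2), IsBranch (a i.castSucc) (a i.succ) (f i) (f' i))
    (lam sig : ℝ) (hlam : 1 < lam) (hls : lam ≤ sig)
    (hbound : ∀ i : Fin (n + 2), ∀ x ∈ Set.Icc (a i.castSucc) (a i.succ),
      lam ≤ f' i x ∧ f' i x ≤ sig)
    (F : ℝ → ℝ) (hF : AgreesWith a f F) (hpres : PreservesLeb F)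
    (δ ε : ℝ) (hδ : 0 < δ) (hδ1 : δ ≤ a 1) (hε : 0 < ε)
    (g : ℝ → ℝ) (wg : ℝ → ℝ) (hwg : IsModulus wg)
    (hwgDini : ∫⁻ t in Set.Ioc (0 : ℝ) 1, ENNReal.ofReal (wg t / t) < ⊤)
    (hgmod : ∀ x ∈ Set.Icc 0 δ, ∀ y ∈ Set.Icc 0 δ, |g x - g y| ≤ wg |x - y|)
    (w : ℝ → ℝ) (hw : IsModulus w)
    (hwpos : ∀ t ∈ Set.Ioc (0 : ℝ) 1, 0 < w t)
    (hwDini : ∫⁻ t in Set.Ioc (0 : ℝ) 1, ENNReal.ofReal (w t / t) = ⊤)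
    (hpert : ∀ x ∈ Set.Icc (0 : ℝ) δ, f' 0 x = g x + ε * w x) :
    UnboundedDistortionFB a f f' := by
  have hr1 : a 1 ≤ 1 := haN ▸ ha.monotone (Fin.le_last 1)
  have hb := hbranch 0
  have hbd := hbound 0
  simp only [Fin.castSucc_zero, Fin.succ_zero_eq_one, ha0] at hb hbd
  have hr0 : 0 ≤ a 1 := hδ.le.trans hδ1
  have hδ1' : δ ≤ 1 := hδ1.trans hr1
  have hlam0 : 0 < lam := zero_lt_one.trans hlam
  have hsig1 : 1 < sig := hlam.trans_le hls
  have hsig0 : 0 < sig := zero_lt_one.trans hsig1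
  obtain ⟨x, hx⟩ := hb.exists_backward_orbit hlam hbd hδ hδ1 hr1
  have hdiv := hw.not_summable_geometric hwDini hδ hδ1' (inv_pos.2 hsig0)
    (inv_lt_one_of_one_lt₀ hsig1)
  have hsum := hwg.summable_geometric hwgDini hδ hδ1' (inv_pos.2 hlam0)
    (inv_lt_one_of_one_lt₀ hlam)
  obtain ⟨-, hwmono, -, hwnn, hw0⟩ := hw
  obtain ⟨-, hgmono, -, hgnn, -⟩ := hwg
  have hmemσ := geometric_mem_Icc hδ hδ1' (inv_pos.2 hsig0) (inv_lt_one_of_one_lt₀ hsig1)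
  have hmemlam := geometric_mem_Icc hδ hδ1' (inv_pos.2 hlam0) (inv_lt_one_of_one_lt₀ hlam)
  have hxr : ∀ m, x m ∈ Icc 0 (a 1) := fun m ↦ ⟨(hx m).1.1, (hx m).1.2.trans hδ1⟩
  have hx1 : ∀ m, x m ∈ Icc (0 : ℝ) 1 := fun m ↦ ⟨(hx m).1.1, (hx m).1.2.trans hδ1'⟩
  have hpos : ∀ y ∈ Icc 0 (a 1), 0 < f' 0 y := fun y hy ↦ hlam0.trans_le (hbd y hy).1
  have h0r : (0 : ℝ) ∈ Icc 0 (a 1) := ⟨le_rfl, hr0⟩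
  have hterm : ∀ m, ε / sig * w (δ * sig⁻¹ ^ m) - wg (δ * lam⁻¹ ^ m) ≤
      Real.log (f' 0 (x m)) - Real.log (f' 0 0) := by
    intro m
    refine le_trans ?_ (sub_div_le_log_sub_log (hpos _ (hxr m)) (hpos _ h0r))
    obtain ⟨hl, hu⟩ := hbd _ (hxr m)
    have hA := hpos _ (hxr m)
    have h1 : w (δ * sig⁻¹ ^ m) ≤ w (x m) := hwmono (hmemσ m) (hx1 m) (hx m).2.2.1
    have h2 : |g (x m) - g 0| ≤ wg (δ * lam⁻¹ ^ m) := by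
      have h := hgmod _ (hx m).1 0 ⟨le_rfl, hδ.le⟩
      rw [sub_zero, abs_of_nonneg (hx m).1.1] at h
      exact h.trans (hgmono (hx1 m) (hmemlam m) (hx m).2.2.2)
    have h3 := (abs_le.1 h2).1
    have hnum : ε * w (δ * sig⁻¹ ^ m) - wg (δ * lam⁻¹ ^ m) ≤ f' 0 (x m) - f' 0 0 := by
      rw [hpert _ (hx m).1, hpert 0 ⟨le_rfl, hδ.le⟩, hw0]
      have := mul_le_mul_of_nonneg_left h1 hε.le
      linarith
    refine le_trans ?_ (div_le_div_of_nonneg_right hnum hA.le)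
    rw [sub_div]
    have h4 : ε / sig * w (δ * sig⁻¹ ^ m) ≤ ε * w (δ * sig⁻¹ ^ m) / f' 0 (x m) := by
      rw [div_mul_eq_mul_div]
      exact div_le_div_of_nonneg_left (mul_nonneg hε.le (hwnn _ (hmemσ m))) hA hu
    have h5 : wg (δ * lam⁻¹ ^ m) / f' 0 (x m) ≤ wg (δ * lam⁻¹ ^ m) :=
      div_le_self (hgnn _ (hmemlam m)) (hlam.le.trans hl)
    linarith
  intro M
  rw [not_summable_iff_tendsto_nat_atTop_of_nonneg fun m ↦ hwnn _ (hmemσ _)] at hdiv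
  obtain ⟨k, hk1, hk⟩ := ((Filter.eventually_ge_atTop 1).and
    ((hdiv.const_mul_atTop (div_pos hε hsig0)).eventually_gt_atTop
      (M + ∑' m : ℕ, wg (δ * lam⁻¹ ^ (m + 1))))).exists
  refine ⟨k, hk1, fun _ ↦ 0, fun l ↦ x (k - l), fun _ ↦ 0, ?_, ?_, ?_⟩
  · intro l hl
    simp only [Fin.castSucc_zero, Fin.succ_zero_eq_one, ha0]
    refine ⟨hxr _, ?_⟩
    rw [← (hx (k - (l + 1))).2.1]
    congr 2
    omega
  · intro l _
    simp only [Fin.castSucc_zero, Fin.succ_zero_eq_one, ha0]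
    exact ⟨h0r, hb.2.2.2.1⟩
  · rw [Real.log_prod fun l _ ↦ (hpos _ (hxr _)).ne', Real.log_prod fun l _ ↦ (hpos _ h0r).ne',
      ← Finset.sum_sub_distrib]
    have hreflect : ∑ l ∈ Finset.range k, (Real.log (f' 0 (x (k - l))) - Real.log (f' 0 0)) =
        ∑ m ∈ Finset.range k, (Real.log (f' 0 (x (m + 1))) - Real.log (f' 0 0)) := by
      rw [← Finset.sum_range_reflect]
      refine Finset.sum_congr rfl fun l hl ↦ ?_
      have := Finset.mem_range.1 hl
      rw [show k - (k - 1 - l) = l + 1 by omega]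
    rw [hreflect]
    have hle := Finset.sum_le_sum fun m (_ : m ∈ Finset.range k) ↦ hterm (m + 1)
    rw [Finset.sum_sub_distrib, ← Finset.mul_sum] at hle
    have htail := hsum.sum_le_tsum (Finset.range k) fun m _ ↦ hgnn _ (hmemlam _)
    linarith
end

section
/- Density of unbounded distortion: for every lift F of a C¹ expanding circle map of degree m ≥ 2 whose induced circle map preserves Lebesgue measure, and for every ε > 0, there exists a lift G of a C¹ expanding circle map of degree m whose induced circle map preserves Lebesgue measure, such that G has unbounded distortion and d_{C¹}(F, G) < ε. -/
open Set MeasureTheory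

/-- `F` is a lift of a C¹ expanding circle map of degree `m ≥ 2`. -/
def IsLiftDeg (m : ℤ) (F : ℝ → ℝ) : Prop :=
  2 ≤ m ∧ ContDiff ℝ 1 F ∧ (∀ x : ℝ, F (x + 1) = F x + m) ∧ ∀ x : ℝ, 1 < deriv F x

/-- The circle map induced by the lift `F` preserves the Haar (Lebesgue)
probability measure on `ℝ/ℤ`. -/
def CirclePreserves (F : ℝ → ℝ) : Prop :=
  ∀ φ : AddCircle (1 : ℝ) → AddCircle (1 : ℝ),
    (∀ x : ℝ, φ x = ((F x : ℝ) : AddCircle (1 : ℝ))) →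
    ∀ A : Set (AddCircle (1 : ℝ)), MeasurableSet A → volume (φ ⁻¹' A) = volume A

/-- The C¹ distance between two lifts:
`sup_{[0,1]} |F - G| + sup_{[0,1]} |F' - G'|`. -/
noncomputable def dC1 (F G : ℝ → ℝ) : ℝ :=
  sSup ((fun x => |F x - G x|) '' Set.Icc 0 1) +
  sSup ((fun x => |deriv F x - deriv G x|) '' Set.Icc 0 1)

/-- The lift `F` has unbounded distortion: the distortions
`d_k(F) = sup {log (Fᵏ)'(x) - log (Fᵏ)'(y) : |Fᵏ(x) - Fᵏ(y)| ≤ 1}` are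
unbounded in `k`. -/
def UnboundedDistortionLift (F : ℝ → ℝ) : Prop :=
  ∀ M : ℝ, ∃ k : ℕ, 1 ≤ k ∧ ∃ x y : ℝ,
    |F^[k] x - F^[k] y| ≤ 1 ∧
    M < Real.log (deriv (F^[k]) x) - Real.log (deriv (F^[k]) y)

/-- A continuous function that commutes with translations up to scale is surjective. -/
lemma surjective_of_map_add {f : ℝ → ℝ} (hf : Continuous f) {a b : ℝ} (hb : 0 < b)
    (hab : ∀ x, f (x + a) = f x + b) : Function.Surjective f := by
  have key : ∀ (n : ℕ) (x : ℝ), f (x + n * a) = f x + n * b := by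
    intro n
    induction n with
    | zero => simp
    | succ k ih =>
      intro x
      have : x + ((k + 1 : ℕ) : ℝ) * a = (x + k * a) + a := by push_cast; ring
      rw [this, hab, ih]; push_cast; ring
  intro y
  obtain ⟨n, hn⟩ := exists_nat_gt (|y - f 0| / b)
  rw [div_lt_iff₀ hb] at hn
  have h1 := key n 0
  have h2 := key n (-(n * a))
  rw [neg_add_cancel] at h2
  rw [zero_add] at h1
  have h3 := abs_lt.1 hn
  exact mem_range_of_exists_le_of_exists_ge hf ⟨-(n * a), by linarith [h3.1]⟩
    ⟨n * a, by linarith [h3.2]⟩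

/-- The inverse of a `C¹` lift with positive derivative is again such a lift. -/
lemma exists_inverse_lift {f f' : ℝ → ℝ} (hf : ∀ x, HasDerivAt f (f' x) x)
    (hpos : ∀ x, 0 < f' x) {a b : ℝ} (hb : 0 < b) (hab : ∀ x, f (x + a) = f x + b) :
    ∃ g : ℝ → ℝ, (∀ y, f (g y) = y) ∧ (∀ x, g (f x) = x) ∧ Continuous g ∧
      (∀ y, g (y + b) = g y + a) ∧ ∀ y, HasDerivAt g (f' (g y))⁻¹ y := by
  have hc : Continuous f := continuous_iff_continuousAt.2 fun x => (hf x).continuousAt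
  have hmono : StrictMono f := strictMono_of_deriv_pos fun x => by
    rw [(hf x).deriv]; exact hpos x
  have hsurj := surjective_of_map_add hc hb hab
  let e := hmono.orderIsoOfSurjective f hsurj
  have h1 : ∀ y, f (e.symm y) = y := fun y => e.apply_symm_apply y
  have h2 : ∀ x, e.symm (f x) = x := fun x => e.symm_apply_apply x
  have h3 : Continuous e.symm := e.symm.continuous
  refine ⟨e.symm, h1, h2, h3, fun y => ?_, fun y => ?_⟩
  · apply hmono.injective
    rw [h1, hab, h1]
  · exact HasDerivAt.of_local_left_inverse h3.continuousAt (hf _) (hpos _).ne'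
      (Filter.Eventually.of_forall h1)

/-- The measure of the preimage of a set under a circle map, in terms of the derivative `h` of an
inverse `H` of its lift. -/
lemma volume_preimage_eq {G H h : ℝ → ℝ} {M p : ℝ} (hG : Continuous G)
    (hGH : ∀ y, G (H y) = y) (hHG : ∀ x, H (G x) = x) (hH : ∀ y, HasDerivAt H (h y) y)
    (hh : ∀ y, 0 < h y) (hc : Continuous h) (hM : 0 ≤ M) (hper : ∀ y, H (y + M) = H y + 1)
    (hp : H p = p)
    {φ : AddCircle (1 : ℝ) → AddCircle (1 : ℝ)}
    (hφ : ∀ x : ℝ, φ x = ((G x : ℝ) : AddCircle (1 : ℝ)))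
    {A : Set (AddCircle (1 : ℝ))} (hA : MeasurableSet A) :
    volume (φ ⁻¹' A) = ENNReal.ofReal
      (∫ x in p..(p + M), ((fun x : ℝ => (x : AddCircle (1 : ℝ))) ⁻¹' A).indicator h x) := by
  have hφc : Continuous φ := by
    have : Continuous (φ ∘ (QuotientAddGroup.mk : ℝ → AddCircle (1 : ℝ))) := by
      have h2 : φ ∘ (QuotientAddGroup.mk : ℝ → AddCircle (1 : ℝ))
          = fun x : ℝ => ((G x : ℝ) : AddCircle (1 : ℝ)) := funext hφ
      rw [h2]
      exact (AddCircle.continuous_mk' 1).comp hG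
    exact continuous_coinduced_dom.2 this
  have hmono : StrictMono H := strictMono_of_deriv_pos fun x => by
    rw [(hH x).deriv]; exact hh x
  have hmA : MeasurableSet ((fun x : ℝ => (x : AddCircle (1 : ℝ))) ⁻¹' A) :=
    (AddCircle.continuous_mk' (1 : ℝ)).measurable hA
  set B := (fun x : ℝ => (x : AddCircle (1 : ℝ))) ⁻¹' A with hB
  have hmφ : MeasurableSet (QuotientAddGroup.mk ⁻¹' (φ ⁻¹' A) : Set ℝ) :=
    (AddCircle.continuous_mk' (1 : ℝ)).measurable (hφc.measurable hA)
  rw [← (AddCircle.measurePreserving_mk 1 p).measure_preimage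
    (hφc.measurable hA).nullMeasurableSet, Measure.restrict_apply hmφ]
  have himg : (QuotientAddGroup.mk ⁻¹' (φ ⁻¹' A) ∩ Ioc p (p + 1) : Set ℝ)
      = H '' (Ioc p (p + M) ∩ B) := by
    ext x
    constructor
    · rintro ⟨hx1, hx2⟩
      have hx1' : G x ∈ B := by
        have : φ (x : AddCircle (1 : ℝ)) ∈ A := hx1
        rwa [hφ] at this
      refine ⟨G x, ⟨⟨?_, ?_⟩, hx1'⟩, hHG x⟩
      · rw [← hmono.lt_iff_lt, hHG, hp]; exact hx2.1
      · rw [← hmono.le_iff_le, hHG, hper, hp]; exact hx2.2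
    · rintro ⟨y, ⟨hy1, hy2⟩, rfl⟩
      refine ⟨?_, ?_, ?_⟩
      · change φ (H y : AddCircle (1 : ℝ)) ∈ A
        rw [hφ, hGH]; exact hy2
      · have := hmono hy1.1; rwa [hp] at this
      · have := hmono.monotone hy1.2; rwa [hper, hp] at this
  rw [himg]
  have h1 := lintegral_image_eq_lintegral_abs_deriv_mul (measurableSet_Ioc.inter hmA)
    (fun x _ => (hH x).hasDerivWithinAt) hmono.injective.injOn (fun _ => 1)
    (s := Ioc p (p + M) ∩ B)
  simp only [lintegral_const, Measure.restrict_apply MeasurableSet.univ, univ_inter, one_mul,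
    mul_one] at h1
  have hint : IntegrableOn h (Ioc p (p + M) ∩ B) :=
    ((hc.integrableOn_Ioc).mono_set inter_subset_left)
  rw [h1, intervalIntegral.integral_of_le (by linarith), setIntegral_indicator hmA,
    ofReal_integral_eq_lintegral_ofReal hint (Filter.Eventually.of_forall fun x => (hh x).le)]
  simp only [abs_of_pos (hh _)]

/-- Adding a term of the form `q - q (· - 1)` does not change the integral over a period of a
density restricted to a `1`-periodic set. -/
lemma integral_indicator_add_sub {h q : ℝ → ℝ} {M p : ℝ} (hc : Continuous h) (hq : Continuous q)
    (hqM : ∀ x, q (x + M) = q x) {B : Set ℝ} (hB : MeasurableSet B)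
    (hB1 : ∀ x, x - 1 ∈ B ↔ x ∈ B) (hBM : ∀ x, x + M ∈ B ↔ x ∈ B) :
    ∫ x in p..(p + M), B.indicator (fun x => h x + q x - q (x - 1)) x
      = ∫ x in p..(p + M), B.indicator h x := by
  have hi : ∀ (g : ℝ → ℝ) (a b : ℝ), Continuous g →
      IntervalIntegrable (B.indicator g) volume a b := by
    intro g a b hg
    have := hg.intervalIntegrable (μ := volume) a b
    exact ⟨this.1.indicator hB, this.2.indicator hB⟩
  have e1 : (fun x => B.indicator (fun x => h x + q x - q (x - 1)) x)
      = fun x => B.indicator h x + B.indicator q x - B.indicator q (x - 1) := by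
    funext x
    by_cases hx : x ∈ B
    · have hx' := (hB1 x).2 hx
      simp [hx, hx']
    · have hx' : x - 1 ∉ B := fun h => hx ((hB1 x).1 h)
      simp [hx, hx']
  have hper : Function.Periodic (B.indicator q) M := by
    intro x
    by_cases hx : x ∈ B
    · simp [hx, (hBM x).2 hx, hqM]
    · have hx' : x + M ∉ B := fun h => hx ((hBM x).1 h)
      simp [hx, hx']
  have e2 : ∫ x in p..(p + M), B.indicator q (x - 1) = ∫ x in p..(p + M), B.indicator q x := by
    rw [intervalIntegral.integral_comp_sub_right (fun x => B.indicator q x) 1,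
      show p + M - 1 = p - 1 + M by ring]
    exact hper.intervalIntegral_add_eq _ _
  have hi3 : IntervalIntegrable (fun x => B.indicator q (x - 1)) volume p (p + M) := by
    have := (hi q (p - 1) (p + M - 1) hq).comp_sub_right 1
    simpa using this
  rw [e1, intervalIntegral.integral_sub ((hi h _ _ hc).add (hi q _ _ hq)) hi3,
    intervalIntegral.integral_add (hi h _ _ hc) (hi q _ _ hq), e2]
  ring

/-- A finite product of factors `1 + f i` with `f i ≥ 0` dominates one plus the sum. -/
lemma one_add_sum_le_prod {f : ℕ → ℝ} (hf : ∀ i, 0 ≤ f i) (n : ℕ) :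
    1 + ∑ i ∈ Finset.range n, f i ≤ ∏ i ∈ Finset.range n, (1 + f i) := by
  induction n with
  | zero => simp
  | succ k ih =>
    rw [Finset.sum_range_succ, Finset.prod_range_succ]
    have h0 : 0 ≤ ∑ i ∈ Finset.range k, f i := Finset.sum_nonneg fun i _ => hf i
    nlinarith [mul_le_mul_of_nonneg_right ih (hf k), mul_nonneg h0 (hf k)]

/-- The derivative of the iterates of a map along an inverse orbit. -/
lemma hasDerivAt_iterate_inverse_orbit {G h : ℝ → ℝ} {x : ℕ → ℝ}
    (hx : ∀ i, G (x (i + 1)) = x i) (hG : ∀ i, HasDerivAt G (h (x i))⁻¹ (x (i + 1))) (k : ℕ) :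
    HasDerivAt (G^[k]) (∏ i ∈ Finset.range k, h (x i))⁻¹ (x k) ∧ G^[k] (x k) = x 0 := by
  induction k with
  | zero => simpa using hasDerivAt_id (x 0)
  | succ k ih =>
    rw [Function.iterate_succ]
    refine ⟨?_, by simp [hx, ih.2]⟩
    have h1 := ih.1
    rw [← hx k] at h1
    have := HasDerivAt.comp (x (k + 1)) h1 (hG k)
    rwa [← mul_inv, ← Finset.prod_range_succ] at this

/-- An inverse branch whose derivative near a fixed point has a logarithmic modulus of continuity
produces unbounded distortion. -/
lemma exists_distortion_gt {G H h e : ℝ → ℝ} {p τ c : ℝ}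
    (hGH : ∀ y, G (H y) = y) (hG : ∀ y, HasDerivAt G (h y)⁻¹ (H y))
    (hH : ∀ y, HasDerivAt H (h y) y) (hp : H p = p) (hτ : 0 < τ) (hτ1 : τ ≤ 1) (hτc : τ < c)
    (hpos : 0 < h p) (hlt : ∀ y, h y < 1)
    (he : ∀ y ∈ Icc p (p + τ), h y = h p + e y)
    (hlog : ∀ y ∈ Ioc p (p + τ), (Real.log (c / (y - p)))⁻¹ ≤ e y) (K : ℝ) :
    ∃ k : ℕ, 1 ≤ k ∧ ∃ x y : ℝ, |G^[k] x - G^[k] y| ≤ 1 ∧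
      K < Real.log (deriv (G^[k]) x) - Real.log (deriv (G^[k]) y) := by
  have hHd : Differentiable ℝ H := fun y => (hH y).differentiableAt
  have hepos : ∀ y ∈ Ioc p (p + τ), 0 < e y := by
    intro y hy
    refine lt_of_lt_of_le ?_ (hlog y hy)
    refine inv_pos.2 (Real.log_pos ?_)
    rw [one_lt_div (by linarith [hy.1])]
    linarith [hy.2]
  have hhp : ∀ y ∈ Ioc p (p + τ), h p ≤ h y := fun y hy => by
    rw [he y (Ioc_subset_Icc_self hy)]; linarith [hepos y hy]
  have hlow : ∀ y ∈ Ioc p (p + τ), h p * (y - p) ≤ H y - p := by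
    intro y hy
    have := (convex_Icc p y).mul_sub_le_image_sub_of_le_deriv hHd.continuous.continuousOn
      hHd.differentiableOn (C := h p) (by
        intro z hz
        rw [interior_Icc] at hz
        rw [(hH z).deriv]
        exact hhp z ⟨hz.1, hz.2.le.trans hy.2⟩) p (left_mem_Icc.2 hy.1.le) y
        (right_mem_Icc.2 hy.1.le) hy.1.le
    rwa [hp] at this
  have hup : ∀ y ∈ Ioc p (p + τ), H y - p ≤ y - p := by
    intro y hy
    have := (convex_Icc p y).image_sub_le_mul_sub_of_deriv_le hHd.continuous.continuousOn
      hHd.differentiableOn (C := 1) (by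
        intro z hz
        rw [(hH z).deriv]
        exact (hlt z).le) p (left_mem_Icc.2 hy.1.le) y
        (right_mem_Icc.2 hy.1.le) hy.1.le
    rwa [hp, one_mul] at this
  set x : ℕ → ℝ := fun i => H^[i] (p + τ) with hxdef
  have hxs : ∀ i, x (i + 1) = H (x i) := fun i => Function.iterate_succ_apply' _ _ _
  have hx : ∀ i, x i ∈ Ioc p (p + τ) ∧ h p ^ i * τ ≤ x i - p := by
    intro i
    induction i with
    | zero => simp [hxdef, hτ]
    | succ i ih =>
      have h1 := hlow _ ih.1
      have h2 := hup _ ih.1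
      have h3 : 0 < h p * (x i - p) := mul_pos hpos (by linarith [ih.1.1])
      rw [hxs]
      refine ⟨⟨by linarith, by linarith [ih.1.2]⟩, ?_⟩
      calc h p ^ (i + 1) * τ = h p * (h p ^ i * τ) := by ring
        _ ≤ h p * (x i - p) := mul_le_mul_of_nonneg_left ih.2 hpos.le
        _ ≤ _ := h1
  set a := Real.log (c / τ) - Real.log (h p) with ha
  have hl1 : Real.log (h p) < 0 := Real.log_neg hpos (hlt p)
  have hl2 : 0 < Real.log (c / τ) := Real.log_pos (by rwa [one_lt_div hτ])
  have ha0 : 0 < a := by linarith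
  have hc : 0 < c := hτ.trans hτc
  have hei : ∀ i : ℕ, a⁻¹ * (1 / ((i : ℝ) + 1)) ≤ e (x i) := by
    intro i
    refine le_trans ?_ (hlog _ (hx i).1)
    rw [one_div, ← mul_inv]
    have hxp : 0 < x i - p := by linarith [(hx i).1.1]
    have hlp : 0 < Real.log (c / (x i - p)) := by
      refine Real.log_pos ?_
      rw [one_lt_div hxp]
      linarith [(hx i).1.2]
    refine inv_anti₀ hlp ?_
    calc Real.log (c / (x i - p)) ≤ Real.log (c / (h p ^ i * τ)) :=
          Real.log_le_log (by positivity) (div_le_div_of_nonneg_left hc.le (by positivity) (hx i).2)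
      _ = Real.log (c / τ) - i * Real.log (h p) := by
          rw [div_mul_eq_div_div_swap, Real.log_div (by positivity) (by positivity), Real.log_pow]
      _ ≤ a * (i + 1) := by
          rw [ha]
          have : (0 : ℝ) ≤ i := i.cast_nonneg
          nlinarith
  have hdiv := Real.tendsto_sum_range_one_div_nat_succ_atTop.eventually_gt_atTop
    (Real.exp K * (a * h p))
  obtain ⟨k, hk, hk1⟩ := (hdiv.and (Filter.eventually_ge_atTop 1)).exists
  have hderiv := hasDerivAt_iterate_inverse_orbit (G := G) (h := h) (x := x)
    (fun i => by rw [hxs, hGH]) (fun i => by rw [hxs]; exact hG _) k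
  have hderivp := hasDerivAt_iterate_inverse_orbit (G := G) (h := h) (x := fun _ => p)
    (fun i => by have := hGH p; rwa [hp] at this) (fun i => by have := hG p; rwa [hp] at this) k
  refine ⟨k, hk1, p, x k, ?_, ?_⟩
  · rw [hderiv.2, hderivp.2]
    simp only [hxdef, Function.iterate_zero, id]
    rw [abs_le]
    constructor <;> linarith
  · rw [hderiv.1.deriv, hderivp.1.deriv]
    have hhx : ∀ i, 0 < h (x i) := fun i => hpos.trans_le (hhp _ (hx i).1)
    have hP : 0 < ∏ i ∈ Finset.range k, h (x i) := Finset.prod_pos fun i _ => hhx i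
    have hP' : 0 < ∏ i ∈ Finset.range k, h p := Finset.prod_pos fun i _ => hpos
    rw [Real.log_inv, Real.log_inv, neg_sub_neg, ← Real.log_div hP.ne' hP'.ne',
      ← Finset.prod_div_distrib, Real.lt_log_iff_exp_lt
        (Finset.prod_pos fun i _ => div_pos (hhx i) hpos)]
    have hprod := one_add_sum_le_prod (f := fun i => e (x i) / h p)
      (fun i => (div_pos (hepos _ (hx i).1) hpos).le) k
    have heq : ∏ i ∈ Finset.range k, (1 + e (x i) / h p)
        = ∏ i ∈ Finset.range k, h (x i) / h p := by
      refine Finset.prod_congr rfl fun i _ => ?_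
      rw [he _ (Ioc_subset_Icc_self (hx i).1)]
      field_simp
    rw [heq] at hprod
    refine lt_of_lt_of_le ?_ hprod
    have hs : (a * h p)⁻¹ * ∑ i ∈ Finset.range k, 1 / ((i : ℝ) + 1)
        ≤ ∑ i ∈ Finset.range k, e (x i) / h p := by
      rw [Finset.mul_sum]
      refine Finset.sum_le_sum fun i _ => ?_
      rw [le_div_iff₀ hpos]
      refine le_trans (le_of_eq ?_) (hei i)
      field_simp
    have : Real.exp K < (a * h p)⁻¹ * ∑ i ∈ Finset.range k, 1 / ((i : ℝ) + 1) := by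
      rw [← div_eq_inv_mul, lt_div_iff₀ (by positivity)]
      exact hk
    linarith

/-- A small periodic perturbation of the density `h` that is supported away from `p - 1` modulo
the period and gives `h` a logarithmic modulus of continuity at `p`. -/
lemma exists_perturbation {h : ℝ → ℝ} {M p η : ℝ} (hc : Continuous h)
    (hper : ∀ x, h (x + M) = h x) (hM : 2 ≤ M) (hη : 0 < η) :
    ∃ q e : ℝ → ℝ, ∃ τ : ℝ, Continuous q ∧ (∀ x, q (x + M) = q x) ∧ (∀ x, |q x| ≤ η) ∧
      0 < τ ∧ τ ≤ 1 ∧ τ < M ∧ e p = 0 ∧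
      (∀ x ∈ Icc p (p + τ), h x + q x - q (x - 1) = h p + e x) ∧
      ∀ x ∈ Ioc p (p + τ), (Real.log (M / (x - p)))⁻¹ ≤ e x := by
  have hM0 : 0 < M := by linarith
  set s : ℝ → ℝ := fun x => |Real.sin (Real.pi * (x - p) / M)| with hs
  have hsc : Continuous s := by fun_prop
  have hs1 : ∀ x, s x ≤ 1 := fun x => Real.abs_sin_le_one _
  have hs0 : ∀ x, 0 ≤ s x := fun x => abs_nonneg _
  have hsp : s p = 0 := by simp [hs]
  have hsM : ∀ x, s (x + M) = s x := by
    intro x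
    have : Real.pi * (x + M - p) / M = Real.pi * (x - p) / M + Real.pi := by field_simp; ring
    simp only [hs]
    rw [this, Real.sin_add_pi, abs_neg]
  have hsp1 : 0 < s (p - 1) := by
    have : Real.pi * (p - 1 - p) / M = -(Real.pi / M) := by ring
    simp only [hs]
    rw [this, Real.sin_neg, abs_neg, abs_pos]
    refine (Real.sin_pos_of_pos_of_lt_pi (by positivity) ?_).ne'
    rw [div_lt_iff₀ hM0]
    nlinarith [Real.pi_pos]
  set e : ℝ → ℝ := fun x => (Real.log (2 / s x))⁻¹ with he
  have hec : Continuous e := by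
    rw [continuous_iff_continuousAt]
    intro x
    by_cases hx : s x = 0
    · have : Filter.Tendsto (fun t : ℝ => (Real.log (2 / t))⁻¹) (nhdsWithin 0 {0}ᶜ) (nhds 0) := by
        have h1 : Filter.Tendsto (fun t : ℝ => Real.log 2 - Real.log t) (nhdsWithin 0 {0}ᶜ)
            Filter.atTop := by
          have := Filter.tendsto_neg_atBot_atTop.comp Real.tendsto_log_nhdsNE_zero
          exact Filter.tendsto_atTop_add_const_left _ (Real.log 2) this
        refine (Filter.Tendsto.inv_tendsto_atTop h1).congr' ?_
        filter_upwards [self_mem_nhdsWithin] with t ht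
        rw [Pi.inv_apply, Real.log_div (by norm_num) ht]
      have h2 : ContinuousAt (fun t : ℝ => (Real.log (2 / t))⁻¹) (s x) := by
        rw [hx, continuousAt_iff_punctured_nhds]
        simpa using this
      exact ContinuousAt.comp (f := s) h2 hsc.continuousAt
    · have hpos : 0 < s x := lt_of_le_of_ne (hs0 x) (Ne.symm hx)
      have hgt : 1 < 2 / s x := by
        rw [one_lt_div hpos]; linarith [hs1 x]
      refine ContinuousAt.inv₀ ?_ (Real.log_pos hgt).ne'
      exact ContinuousAt.log (continuousAt_const.div hsc.continuousAt hx) (by linarith)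
  have hep : e p = 0 := by simp [he, hsp]
  have heM : ∀ x, e (x + M) = e x := fun x => by simp only [he, hsM]
  set χ : ℝ → ℝ := fun x => max 0 (min 1 (2 - 3 * s x / s (p - 1))) with hχ
  have hχc : Continuous χ := by fun_prop
  set q : ℝ → ℝ := fun x => χ x * max (-η) (min η (h p + e x - h x)) with hq
  have hqc : Continuous q := by fun_prop
  have hqη : ∀ x, |q x| ≤ η := by
    intro x
    simp only [hq]
    rw [abs_mul]
    have h1 : |χ x| ≤ 1 := abs_le.2 ⟨by linarith [le_max_left 0 (min 1 (2 - 3 * s x / s (p - 1)))],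
      max_le (by norm_num) (min_le_left _ _)⟩
    have h2 : |max (-η) (min η (h p + e x - h x))| ≤ η :=
      abs_le.2 ⟨le_max_left _ _, max_le (by linarith) (min_le_left _ _)⟩
    calc _ ≤ 1 * η := mul_le_mul h1 h2 (abs_nonneg _) (by norm_num)
      _ = η := one_mul _
  have hev1 : ∀ᶠ x in nhds p, s x < s (p - 1) / 3 :=
    hsc.continuousAt.eventually_lt continuousAt_const (by rw [hsp]; positivity)
  have hev2 : ∀ᶠ x in nhds p, 2 / 3 * s (p - 1) < s (x - 1) :=
    continuousAt_const.eventually_lt (f := fun _ => 2 / 3 * s (p - 1)) (by fun_prop) (by linarith)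
  have hev3 : ∀ᶠ x in nhds p, |h p + e x - h x| < η :=
    ContinuousAt.eventually_lt (by fun_prop) continuousAt_const (by simpa [hep] using hη)
  obtain ⟨δ, hδ, hball⟩ := Metric.eventually_nhds_iff.1 (hev1.and (hev2.and hev3))
  refine ⟨q, e, min (δ / 2) 1, hqc, fun x => by simp only [hq, hχ, hsM, heM, hper], hqη, by positivity,
    min_le_right _ _, lt_of_le_of_lt (min_le_right _ _) (by linarith), hep, ?_, ?_⟩
  · intro x hx
    have hx2 := hx.2.trans (add_le_add_right (min_le_left (δ / 2) 1) p)
    obtain ⟨h1, h2, h3⟩ := hball (y := x) (by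
      rw [Real.dist_eq, abs_of_nonneg (by linarith [hx.1])]
      linarith)
    have hχ1 : χ x = 1 := by
      simp only [hχ]
      have : 3 * s x / s (p - 1) ≤ 1 := by rw [div_le_one hsp1]; linarith
      rw [min_eq_left (by linarith)]; norm_num
    have hχ2 : χ (x - 1) = 0 := by
      simp only [hχ]
      refine max_eq_left ((min_le_right _ _).trans ?_)
      have : 2 ≤ 3 * s (x - 1) / s (p - 1) := by rw [le_div_iff₀ hsp1]; linarith
      linarith
    have h4 := abs_lt.1 h3
    simp only [hq]
    rw [hχ1, hχ2, min_eq_right h4.2.le, max_eq_right h4.1.le]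
    ring
  · intro x hx
    have hx2 := hx.2.trans (add_le_add_right (min_le_right (δ / 2) 1) p)
    have hx0 : 0 < x - p := by linarith [hx.1]
    have hle : 2 * ((x - p) / M) ≤ s x := by
      have h1 : 0 ≤ Real.pi * (x - p) / M := by positivity
      have h2 : Real.pi * (x - p) / M ≤ Real.pi / 2 := by
        rw [div_le_div_iff₀ hM0 (by norm_num)]
        nlinarith [Real.pi_pos]
      have h3 := Real.mul_le_sin h1 h2
      refine le_trans (le_of_eq ?_) (h3.trans (le_abs_self _))
      field_simp
    have hspos : 0 < s x := lt_of_lt_of_le (by positivity) hle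
    simp only [he]
    refine inv_anti₀ (Real.log_pos ?_) (Real.log_le_log (by positivity) ?_)
    · rw [one_lt_div hspos]; linarith [hs1 x]
    · rw [div_le_div_iff₀ hspos hx0]
      have := mul_le_mul_of_nonneg_left hle hM0.le
      have h5 : M * (2 * ((x - p) / M)) = 2 * (x - p) := by field_simp
      linarith

/-- density of unbounded distortion: every Lebesgue-preserving
C¹ expanding circle map of degree `m ≥ 2` is approximated, arbitrarily well in
the C¹ distance, by Lebesgue-preserving C¹ expanding circle maps of degree `m`
with unbounded distortion. -/
theorem unbounded_distortion_dense (m : ℤ) (F : ℝ → ℝ)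
    (hF : IsLiftDeg m F) (hpres : CirclePreserves F)
    (ε : ℝ) (hε : 0 < ε) :
    ∃ G : ℝ → ℝ, IsLiftDeg m G ∧ CirclePreserves G ∧
      UnboundedDistortionLift G ∧ dC1 F G < ε := by
  obtain ⟨hm, hC1, hper, hexp⟩ := hF
  have hM : (2 : ℝ) ≤ m := by exact_mod_cast hm
  have hM0 : (0 : ℝ) < m := by linarith
  obtain ⟨hFd, hFc'⟩ := contDiff_one_iff_deriv.1 hC1
  have hFc := hFd.continuous
  obtain ⟨p, hp⟩ : ∃ p, F p = p := by
    obtain ⟨p, hp⟩ := surjective_of_map_add (f := fun x => F x - x) (hFc.sub continuous_id)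
      (a := 1) (b := m - 1) (by linarith) (fun x => by simp only [hper]; ring) 0
    exact ⟨p, by simpa [sub_eq_zero] using hp⟩
  obtain ⟨H, hFH, hHF, hHc, hHper, hHd⟩ := exists_inverse_lift
    (fun x => (hFd x).hasDerivAt) (fun x => one_pos.trans (hexp x)) hM0 hper
  have hHp : H p = p := by simpa [hp] using hHF p
  have hF'per : ∀ x, deriv F (x + 1) = deriv F x := fun x => by
    rw [← deriv_comp_add_const, show (fun x => F (x + 1)) = fun x => F x + m from funext hper,
      deriv_add_const]
  set h : ℝ → ℝ := fun y => (deriv F (H y))⁻¹ with hh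
  have hF'h : ∀ x, deriv F x = (h (F x))⁻¹ := fun x => by simp [hh, hHF]
  have hpos : ∀ y, 0 < h y := fun y => inv_pos.2 (one_pos.trans (hexp _))
  have hlt : ∀ y, h y < 1 := fun y => inv_lt_one_of_one_lt₀ (hexp _)
  have hhc : Continuous h :=
    (hFc'.comp hHc).inv₀ fun y => (one_pos.trans (hexp _)).ne'
  have hhper : ∀ y, h (y + m) = h y := fun y => by simp only [hh, hHper, hF'per]
  have hcomp : IsCompact (range h) :=
    Function.Periodic.compact_of_continuous hhper hM0.ne' hhc
  obtain ⟨a, ha0, ha⟩ : ∃ a, 0 < a ∧ ∀ y, a ≤ h y := by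
    obtain ⟨_, ⟨y, rfl⟩, hy⟩ := hcomp.exists_isLeast (range_nonempty h)
    exact ⟨h y, hpos y, fun z => hy (mem_range_self z)⟩
  obtain ⟨b, hb1, hb⟩ : ∃ b, b < 1 ∧ ∀ y, h y ≤ b := by
    obtain ⟨_, ⟨y, rfl⟩, hy⟩ := hcomp.exists_isGreatest (range_nonempty h)
    exact ⟨h y, hlt y, fun z => hy (mem_range_self z)⟩
  obtain ⟨δ, hδ, hunif⟩ := Metric.uniformContinuousOn_iff.1
    ((isCompact_Icc (a := F 0 - 1) (b := F 1 + 1)).uniformContinuousOn_of_continuous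
      hhc.continuousOn) (ε * a ^ 2 / 16) (by positivity)
  obtain ⟨η, hη, hη1, hη2, hη3, hη4⟩ : ∃ η, 0 < η ∧ η ≤ a / 4 ∧ η ≤ (1 - b) / 4 ∧
      η ≤ ε * a ^ 2 / 32 ∧ η ≤ a / (2 * m) * min (δ / 2) (min 1 (ε / 4)) := by
    have h1b : 0 < 1 - b := by linarith
    refine ⟨min (a / 4) (min ((1 - b) / 4) (min (ε * a ^ 2 / 32)
      (a / (2 * m) * min (δ / 2) (min 1 (ε / 4))))), by positivity, ?_, ?_, ?_, ?_⟩
    · exact min_le_left _ _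
    · exact (min_le_right _ _).trans (min_le_left _ _)
    · exact (min_le_right _ _).trans ((min_le_right _ _).trans (min_le_left _ _))
    · exact (min_le_right _ _).trans ((min_le_right _ _).trans (min_le_right _ _))
  obtain ⟨q, e, τ, hqc, hqper, hqη, hτ, hτ1, hτm, hep, hloc, hlog⟩ :=
    exists_perturbation hhc hhper hM hη (p := p)
  set h₁ : ℝ → ℝ := fun x => h x + q x - q (x - 1) with hh₁
  have hh₁c : Continuous h₁ := by fun_prop
  have hdiff : ∀ x, |h₁ x - h x| ≤ 2 * η := fun x => by
    have h1 := abs_le.1 (hqη x)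
    have h2 := abs_le.1 (hqη (x - 1))
    simp only [hh₁]
    rw [abs_le]
    constructor <;> linarith
  have ha₁ : ∀ x, a / 2 ≤ h₁ x := fun x => by
    linarith [(abs_le.1 (hdiff x)).1, ha x]
  have hpos₁ : ∀ x, 0 < h₁ x := fun x => by linarith [ha₁ x]
  have hlt₁ : ∀ x, h₁ x < 1 := fun x => by
    linarith [(abs_le.1 (hdiff x)).2, hb x]
  have hh₁per : ∀ x, h₁ (x + m) = h₁ x := fun x => by
    simp only [hh₁]
    rw [hhper, hqper, show x + (m : ℝ) - 1 = x - 1 + m by ring, hqper]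
  have hint : ∀ u v, IntervalIntegrable h₁ volume u v := fun u v => hh₁c.intervalIntegrable u v
  have hftc : ∀ u v, ∫ x in u..v, h x = H v - H u := fun u v =>
    intervalIntegral.integral_eq_sub_of_hasDerivAt (fun y _ => hHd y) (hhc.intervalIntegrable u v)
  set H₁ : ℝ → ℝ := fun x => p + ∫ t in p..x, h₁ t with hH₁
  have hH₁p : H₁ p = p := by simp [hH₁]
  have hH₁d : ∀ y, HasDerivAt H₁ (h₁ y) y := fun y =>
    (hh₁c.integral_hasStrictDerivAt p y).hasDerivAt.const_add p
  have hH₁per : ∀ y, H₁ (y + m) = H₁ y + 1 := fun y => by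
    have h1 := integral_indicator_add_sub (p := p) hhc hqc hqper MeasurableSet.univ (by simp)
      (by simp)
    simp only [indicator_univ] at h1
    have h2 : ∫ x in y..(y + m), h₁ x = ∫ x in p..(p + m), h₁ x :=
      Function.Periodic.intervalIntegral_add_eq hh₁per y p
    have h3 := intervalIntegral.integral_add_adjacent_intervals (hint p y) (hint y (y + m))
    simp only [hH₁]
    rw [← h3, h2, h1, hftc, hHper]
    ring
  have hclose : ∀ y, |H₁ y - H y| ≤ 2 * η * m := by
    have hP : Function.Periodic (fun y => H₁ y - H y) m := fun y => by
      simp only [hH₁per, hHper]; ring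
    intro y
    obtain ⟨z, hz, hyz⟩ := hP.exists_mem_Ico hM0 y p
    rw [hyz]
    have h1 : H₁ z - H z = ∫ t in p..z, (h₁ t - h t) := by
      rw [intervalIntegral.integral_sub (hint _ _) (hhc.intervalIntegrable _ _), hftc, hHp]
      simp only [hH₁]; ring
    rw [h1]
    have h2 := intervalIntegral.norm_integral_le_of_norm_le_const (a := p) (b := z)
      (f := fun t => h₁ t - h t) (C := 2 * η) fun t _ => hdiff t
    refine h2.trans (mul_le_mul_of_nonneg_left ?_ (by positivity))
    rw [abs_of_nonneg (by linarith [hz.1])]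
    linarith [hz.2]
  obtain ⟨G, hHG, hGH, hGc, hGper, hGd⟩ := exists_inverse_lift hH₁d hpos₁ one_pos hH₁per
  have hG' : ∀ x, deriv G x = (h₁ (G x))⁻¹ := fun x => (hGd x).deriv
  refine ⟨G, ⟨hm, contDiff_one_iff_deriv.2 ⟨fun x => (hGd x).differentiableAt, ?_⟩, hGper, ?_⟩,
    ?_, ?_, ?_⟩
  · rw [show deriv G = fun x => (h₁ (G x))⁻¹ from funext hG']
    exact (hh₁c.comp hGc).inv₀ fun x => (hpos₁ _).ne'
  · intro x
    rw [hG']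
    exact (one_lt_inv₀ (hpos₁ _)).2 (hlt₁ _)
  · intro φ hφ A hA
    obtain ⟨ψ, hψ⟩ : ∃ ψ : AddCircle (1 : ℝ) → AddCircle (1 : ℝ),
        ∀ x : ℝ, ψ x = ((F x : ℝ) : AddCircle (1 : ℝ)) := by
      have hP : Function.Periodic (fun x => ((F x : ℝ) : AddCircle (1 : ℝ))) 1 := fun x => by
        simp only [hper, AddCircle.coe_add]
        have : ((m : ℝ) : AddCircle (1 : ℝ)) = 0 :=
          (AddCircle.coe_eq_zero_iff 1).2 ⟨m, by simp⟩
        rw [this, add_zero]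
      exact ⟨hP.lift, fun x => hP.lift_coe x⟩
    rw [← hpres ψ hψ A hA, volume_preimage_eq hGc hGH hHG hH₁d hpos₁ hh₁c hM0.le hH₁per hH₁p hφ hA,
      volume_preimage_eq hFc hFH hHF hHd hpos hhc hM0.le hHper hHp hψ hA]
    congr 1
    refine integral_indicator_add_sub hhc hqc hqper
      ((AddCircle.continuous_mk' (1 : ℝ)).measurable hA) (fun x => ?_) fun x => ?_
    · have : ((x - 1 : ℝ) : AddCircle (1 : ℝ)) = x := by
        rw [AddCircle.coe_sub, AddCircle.coe_period, sub_zero]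
      simp only [mem_preimage, this]
    · have : ((x + m : ℝ) : AddCircle (1 : ℝ)) = x := by
        have h0 : ((m : ℝ) : AddCircle (1 : ℝ)) = 0 :=
          (AddCircle.coe_eq_zero_iff 1).2 ⟨m, by simp⟩
        rw [AddCircle.coe_add, h0, add_zero]
      simp only [mem_preimage, this]
  · have hp1 : h₁ p = h p := by
      have := hloc p (left_mem_Icc.2 (by linarith))
      rw [hep, add_zero] at this
      exact this
    refine exists_distortion_gt (e := e) hGH (fun y => ?_) hH₁d hH₁p hτ hτ1 hτm (hpos₁ p) hlt₁
      (fun y hy => ?_) hlog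
    · have := hGd (H₁ y)
      rwa [hGH] at this
    · rw [hp1]; exact hloc y hy
  · have hlip : ∀ u v, |F u - F v| ≤ a⁻¹ * |u - v| := fun u v =>
      Convex.norm_image_sub_le_of_norm_deriv_le (f := F) (s := univ) (fun x _ => hFd x)
        (fun x _ => by
          rw [hF'h, Real.norm_of_nonneg (inv_pos.2 (hpos _)).le]
          exact inv_anti₀ ha0 (ha _)) convex_univ (mem_univ v) (mem_univ u)
    have hFG : ∀ x, |F x - G x| ≤ min (δ / 2) (min 1 (ε / 4)) := fun x => by
      have h1 := hlip (H₁ (G x)) (H (G x))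
      have h2 := hclose (G x)
      rw [hFH] at h1
      rw [hHG] at h1 h2
      calc _ ≤ _ := h1
        _ ≤ a⁻¹ * (2 * η * m) := mul_le_mul_of_nonneg_left h2 (inv_pos.2 ha0).le
        _ ≤ a⁻¹ * (2 * (a / (2 * m) * min (δ / 2) (min 1 (ε / 4))) * m) := by gcongr
        _ = _ := by field_simp
    have hFmono : StrictMono F := strictMono_of_deriv_pos fun x => one_pos.trans (hexp x)
    have hF'G' : ∀ x ∈ Icc (0 : ℝ) 1, |deriv F x - deriv G x| ≤ ε / 4 := by
      intro x hx
      have hd := hFG x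
      have hF0 := hFmono.monotone hx.1
      have hF1 := hFmono.monotone hx.2
      have hd1 := abs_le.1 (hd.trans ((min_le_right _ _).trans (min_le_left _ _)))
      have hu := hunif (F x) ⟨by linarith, by linarith⟩ (G x) ⟨by linarith, by linarith⟩ (by
        rw [Real.dist_eq]
        linarith [hd.trans (min_le_left _ _)])
      rw [Real.dist_eq] at hu
      have hnum : |h₁ (G x) - h (F x)| ≤ ε * a ^ 2 / 8 := by
        have h1 := abs_lt.1 hu
        have h2 := abs_le.1 (hdiff (G x))
        rw [abs_le]
        constructor <;> linarith
      rw [hF'h, hG', inv_sub_inv (hpos _).ne' (hpos₁ _).ne', abs_div,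
        abs_of_pos (mul_pos (hpos (F x)) (hpos₁ (G x))),
        div_le_iff₀ (mul_pos (hpos (F x)) (hpos₁ (G x)))]
      calc _ ≤ ε * a ^ 2 / 8 := hnum
        _ = ε / 4 * (a * (a / 2)) := by ring
        _ ≤ _ := by
          have := mul_le_mul (ha (F x)) (ha₁ (G x)) (by positivity) (hpos _).le
          gcongr
    have hne : (Icc (0 : ℝ) 1).Nonempty := ⟨0, by simp⟩
    have s1 : sSup ((fun x => |F x - G x|) '' Icc 0 1) ≤ ε / 4 := by
      refine csSup_le (hne.image _) ?_
      rintro _ ⟨x, -, rfl⟩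
      exact (hFG x).trans ((min_le_right _ _).trans (min_le_right _ _))
    have s2 : sSup ((fun x => |deriv F x - deriv G x|) '' Icc 0 1) ≤ ε / 4 := by
      refine csSup_le (hne.image _) ?_
      rintro _ ⟨x, hx, rfl⟩
      exact hF'G' x hx
    unfold dC1
    linarith
end

section
/- Residuality of strict expansion: let Γ*_λ be the set of continuously differentiable maps F : ℝ → ℝ such that F(x+1) = F(x) + m for all x and some integer m ≥ 2, F'(x) ≥ 1 for all x, and the induced circle map preserves Lebesgue measure; and let Γ_λ ⊆ Γ*_λ consist of those F with F'(x) > 1 for all x. Then, with the C¹ topology on Γ*_λ, the subset Γ_λ is a dense G_δ (hence residual) subset of Γ*_λ. -/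
open Set MeasureTheory

/-- The pair `p = (φ, ψ)` of continuous functions on `[0,1]` represents the map
`F : ℝ → ℝ`: `φ = F|_{[0,1]}` and `ψ = F'|_{[0,1]}`.  This is the injection
giving the C¹ topology. -/
def RepresentsPair (p : C(Set.Icc (0 : ℝ) 1, ℝ) × C(Set.Icc (0 : ℝ) 1, ℝ))
    (F : ℝ → ℝ) : Prop :=
  ∀ x : Set.Icc (0 : ℝ) 1, p.1 x = F x ∧ p.2 x = deriv F x

/-- `Γ*_λ`: (the C¹-embedded copy of) the set of C¹ maps `F : ℝ → ℝ` with
`F(x+1) = F(x) + m` for some integer `m ≥ 2`, `F' ≥ 1` everywhere, whose induced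
circle map preserves Lebesgue measure. -/
def GammaStarSet : Set (C(Set.Icc (0 : ℝ) 1, ℝ) × C(Set.Icc (0 : ℝ) 1, ℝ)) :=
  {p | ∃ (F : ℝ → ℝ) (m : ℤ), 2 ≤ m ∧ ContDiff ℝ 1 F ∧
    (∀ x : ℝ, F (x + 1) = F x + m) ∧ (∀ x : ℝ, 1 ≤ deriv F x) ∧
    CirclePreserves F ∧ RepresentsPair p F}

/-- `Γ_λ`: the subset of `Γ*_λ` of maps with `F' > 1` everywhere. -/
def GammaLamSet : Set (C(Set.Icc (0 : ℝ) 1, ℝ) × C(Set.Icc (0 : ℝ) 1, ℝ)) :=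
  {p | ∃ (F : ℝ → ℝ) (m : ℤ), 2 ≤ m ∧ ContDiff ℝ 1 F ∧
    (∀ x : ℝ, F (x + 1) = F x + m) ∧ (∀ x : ℝ, 1 < deriv F x) ∧
    CirclePreserves F ∧ RepresentsPair p F}

theorem HasDerivAt.exists_forall_lt_add_mul {f : ℝ → ℝ} {f' x c : ℝ}
    (hf : HasDerivAt f f' x) (hc : f' < c) :
    ∃ r > 0, ∀ t, 0 < t → t < r → f (x + t) < f x + c * t := by
  have h := hf.tendsto_slope_zero_right.eventually_lt_const hc
  obtain ⟨r, hr, hr'⟩ := mem_nhdsGT_iff_exists_Ioo_subset.1 h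
  refine ⟨r, hr, fun t ht htr ↦ ?_⟩
  have h1 : t⁻¹ • (f (x + t) - f x) < c := hr' ⟨ht, htr⟩
  rw [smul_eq_mul, inv_mul_lt_iff₀ ht] at h1
  linarith

theorem add_sub_le_of_one_le_deriv {F : ℝ → ℝ} (hF : Differentiable ℝ F)
    (h : ∀ x, 1 ≤ deriv F x) {x y : ℝ} (hxy : x ≤ y) : y - x ≤ F y - F x := by
  have := mul_sub_le_image_sub_of_le_deriv hF h hxy
  linarith

theorem AddCircle.volume_eq_volume_inter_Ioc (a : ℝ) {B : Set (AddCircle (1 : ℝ))}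
    (hB : MeasurableSet B) :
    volume B = volume ((fun x : ℝ ↦ (x : AddCircle (1 : ℝ))) ⁻¹' B ∩ Ioc a (a + 1)) := by
  have h := AddCircle.measurePreserving_mk (1 : ℝ) a
  rw [← h.measure_preimage hB.nullMeasurableSet,
    Measure.restrict_apply (h.measurable hB)]

theorem AddCircle.volume_image_Ioo_le (a : ℝ) {e : ℝ} (he : e ≤ 1) :
    volume ((fun x : ℝ ↦ (x : AddCircle (1 : ℝ))) '' Ioo a (a + e)) ≤ ENNReal.ofReal e := by
  have hA : IsOpen ((fun x : ℝ ↦ (x : AddCircle (1 : ℝ))) '' Ioo a (a + e)) :=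
    QuotientAddGroup.isOpenMap_coe _ isOpen_Ioo
  rw [AddCircle.volume_eq_volume_inter_Ioc a hA.measurableSet]
  calc _ ≤ volume (Ioo a (a + e)) := by
        refine measure_mono ?_
        rintro z ⟨⟨w, hw, hwz⟩, hz⟩
        obtain ⟨n, hn⟩ := (QuotientAddGroup.eq_iff_sub_mem.1 hwz :
          w - z ∈ AddSubgroup.zmultiples (1 : ℝ))
        simp only [zsmul_eq_mul, mul_one] at hn
        have h1 : (n : ℝ) < 1 := by linarith [hw.2, hz.1]
        have h2 : (-1 : ℝ) < n := by linarith [hw.1, hz.2]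
        have h3 : n = 0 := by
          have h1' : n < 1 := by exact_mod_cast h1
          have h2' : -1 < n := by exact_mod_cast h2
          omega
        have : z = w := by
          rw [h3] at hn
          push_cast at hn
          linarith
        rwa [this]
    _ = ENNReal.ofReal e := by rw [Real.volume_Ioo]; congr 1; ring

/-- A measure-preserving circle map of degree at least two with `F' ≥ 1` is strictly expanding:
near a point with derivative one, a second inverse branch would make preimages too large. -/
theorem one_lt_deriv_of_circlePreserves {F : ℝ → ℝ} {m : ℤ} (hm : 2 ≤ m)
    (hF : Differentiable ℝ F) (hper : ∀ x : ℝ, F (x + 1) = F x + m)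
    (hder : ∀ x : ℝ, 1 ≤ deriv F x) (hpres : CirclePreserves F) (x₀ : ℝ) :
    1 < deriv F x₀ := by
  by_contra hx₀
  have hd0 : deriv F x₀ ≤ 1 := not_lt.1 hx₀
  have hm' : (2 : ℝ) ≤ m := by exact_mod_cast hm
  have hexp : ∀ {x y : ℝ}, x ≤ y → y - x ≤ F y - F x := add_sub_le_of_one_le_deriv hF hder
  have hmono : StrictMono F := fun x y hxy ↦ by linarith [hexp hxy.le]
  obtain ⟨x₁, -, hx₁⟩ : F x₀ + 1 ∈ F '' Icc x₀ (x₀ + 1) :=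
    intermediate_value_Icc (by linarith) hF.continuous.continuousOn
      ⟨by linarith, by rw [hper]; linarith⟩
  set K := deriv F x₁ + 1 with hK
  have hK2 : 2 ≤ K := by linarith [hder x₁]
  have hK0 : 0 < K := by linarith
  have hKinv : 0 < K⁻¹ := inv_pos.2 hK0
  have hKinv1 : K⁻¹ ≤ 1 := inv_le_one_of_one_le₀ (by linarith)
  obtain ⟨r, hr, hr'⟩ :=
    (hF x₀).hasDerivAt.exists_forall_lt_add_mul (c := 1 + K⁻¹) (by linarith)
  obtain ⟨s, hs, hs'⟩ :=
    (hF x₁).hasDerivAt.exists_forall_lt_add_mul (c := K) (by linarith)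
  obtain ⟨a, ha, ha'⟩ := exists_between (show 0 < min (1 / 2) (min r s) by positivity)
  simp only [lt_min_iff] at ha'
  obtain ⟨ha2, har, has⟩ := ha'
  set b := K⁻¹ * a with hb
  have hb0 : 0 < b := by positivity
  have hba : b ≤ a := by nlinarith
  have hKb : K * b = a := by rw [hb, ← mul_assoc, mul_inv_cancel₀ hK0.ne', one_mul]
  have hFa := hr' a ha har
  have hFb := hs' b hb0 (by linarith)
  rw [hKb] at hFb
  have hFa1 := hexp (show x₀ ≤ x₀ + a by linarith)
  set e := F (x₀ + a) - F x₀ with he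
  have hea : e < a + b := by rw [he, hb]; linarith
  have he1 : e ≤ 1 := by linarith
  have hsep : x₀ + a < x₁ := hmono.lt_iff_lt.1 (by linarith)
  have hend : x₁ + b < x₀ + 1 := hmono.lt_iff_lt.1 (by rw [hper]; linarith)
  have hperiodic : Function.Periodic (fun x ↦ ((F x : ℝ) : AddCircle (1 : ℝ))) 1 := fun x ↦ by
    have h0 : ((m : ℝ) : AddCircle (1 : ℝ)) = 0 :=
      (AddCircle.coe_eq_zero_iff 1).2 ⟨m, by simp⟩
    simp only [hper, AddCircle.coe_add, h0, add_zero]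
  set φ : AddCircle (1 : ℝ) → AddCircle (1 : ℝ) := hperiodic.lift
  have hφF : ∀ x : ℝ, φ x = ((F x : ℝ) : AddCircle (1 : ℝ)) := fun x ↦ hperiodic.lift_coe x
  have hφc : Continuous φ :=
    continuous_quot_lift _ ((AddCircle.continuous_mk' 1).comp hF.continuous)
  set A := (fun x : ℝ ↦ (x : AddCircle (1 : ℝ))) '' Ioo (F x₀) (F x₀ + e)
  have hAo : IsOpen A := QuotientAddGroup.isOpenMap_coe _ isOpen_Ioo
  have hsub : Ioo x₀ (x₀ + a) ∪ Ioo x₁ (x₁ + b) ⊆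
      (fun x : ℝ ↦ (x : AddCircle (1 : ℝ))) ⁻¹' (φ ⁻¹' A) ∩ Ioc x₀ (x₀ + 1) := by
    rintro z (hz | hz)
    · refine ⟨?_, hz.1, by linarith [hz.2]⟩
      simp only [mem_preimage, hφF]
      exact ⟨F z, ⟨hmono hz.1, by linarith [hmono hz.2]⟩, rfl⟩
    · refine ⟨?_, by linarith [hz.1], by linarith [hz.2]⟩
      simp only [mem_preimage, hφF]
      refine ⟨F z - 1, ⟨by linarith [hmono hz.1], by linarith [hmono hz.2]⟩, ?_⟩
      simp [AddCircle.coe_period]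
  have hdisj : Disjoint (Ioo x₀ (x₀ + a)) (Ioo x₁ (x₁ + b)) :=
    Set.disjoint_left.2 fun z hz hz' ↦ by linarith [hz.2, hz'.1]
  have hle : ENNReal.ofReal (a + b) ≤ ENNReal.ofReal e := by
    calc ENNReal.ofReal (a + b) = volume (Ioo x₀ (x₀ + a) ∪ Ioo x₁ (x₁ + b)) := by
          rw [measure_union hdisj measurableSet_Ioo, Real.volume_Ioo, Real.volume_Ioo,
            add_sub_cancel_left, add_sub_cancel_left, ENNReal.ofReal_add ha.le hb0.le]
      _ ≤ _ := measure_mono hsub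
      _ = volume (φ ⁻¹' A) :=
          (AddCircle.volume_eq_volume_inter_Ioc x₀ (hAo.preimage hφc).measurableSet).symm
      _ = volume A := hpres φ hφF A hAo.measurableSet
      _ ≤ ENNReal.ofReal e := AddCircle.volume_image_Ioo_le _ he1
  linarith [(ENNReal.ofReal_le_ofReal_iff (by linarith)).1 hle]

theorem gammaStarSet_subset_gammaLamSet : GammaStarSet ⊆ GammaLamSet := by
  rintro p ⟨F, m, hm, hF, hper, hder, hpres, hp⟩
  exact ⟨F, m, hm, hF, hper,
    one_lt_deriv_of_circlePreserves hm (hF.differentiable one_ne_zero) hper hder hpres, hpres, hp⟩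

/-- residuality of strict expansion: in the C¹ topology (the
subspace topology of `C([0,1],ℝ) × C([0,1],ℝ)`), `Γ_λ` is a dense `G_δ`
(hence residual) subset of its completion `Γ*_λ`. -/
theorem strict_expansion_residual :
    Dense {p : ↥GammaStarSet | (p : C(Set.Icc (0 : ℝ) 1, ℝ) × C(Set.Icc (0 : ℝ) 1, ℝ)) ∈ GammaLamSet} ∧
    IsGδ {p : ↥GammaStarSet | (p : C(Set.Icc (0 : ℝ) 1, ℝ) × C(Set.Icc (0 : ℝ) 1, ℝ)) ∈ GammaLamSet} := by
  have h : {p : ↥GammaStarSet |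
      (p : C(Set.Icc (0 : ℝ) 1, ℝ) × C(Set.Icc (0 : ℝ) 1, ℝ)) ∈ GammaLamSet} = univ :=
    eq_univ_of_forall fun p ↦ gammaStarSet_subset_gammaLamSet p.2
  rw [h]
  exact ⟨dense_univ, IsGδ.univ⟩
end
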